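/- Local interior gradient bound for the discounted state-constraint solutions: let f ∈ C(Ω̄) and m > 2, and for 0 < λ < 1 let u_λ be the unique continuous viscosity solution of the state-constraint problem −Δu_λ + |Du_λ|^m + λu_λ = f in Ω, −Δu_λ + |Du_λ|^m + λu_λ ≥ f on ∂Ω. Then there exists a constant Λ > 0, depending only on m, Ω̄ and f (in particular independent of λ), such that u_λ is locally Lipschitz in Ω and |Du_λ(x)| ≤ Λ · d(x)^{−1/(m−1)} for every x ∈ Ω at which u_λ is differentiable. -/

import Mathlib

open Set Filter Topology Metric MeasureTheory

noncomputable section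

/-- Euclidean space `ℝ^N`. -/
abbrev Euc (N : ℕ) : Type := EuclideanSpace ℝ (Fin N)

/-- The Laplacian of `φ` at `x`, computed as the trace of the second derivative
in the standard orthonormal basis of `ℝ^N`. -/
noncomputable def lapl {N : ℕ} (φ : Euc N → ℝ) (x : Euc N) : ℝ :=
  ∑ i : Fin N,
    iteratedFDeriv ℝ 2 φ x ![EuclideanSpace.single i 1, EuclideanSpace.single i 1]

/-- `Ω` is a domain with `C²` boundary: it is the sublevel set of a `C²`
defining function whose gradient does not vanish on the boundary. -/
def HasC2Boundary {N : ℕ} (Ω : Set (Euc N)) : Prop :=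
  ∃ ρ : Euc N → ℝ, ContDiff ℝ 2 ρ ∧ Ω = {x | ρ x < 0} ∧
    frontier Ω = {x | ρ x = 0} ∧ ∀ x ∈ frontier Ω, gradient ρ x ≠ 0

/-- The stationary operator `−Δφ(x) + |Dφ(x)|^m + λ r − h(x)` evaluated with the
value `r` of the (sub/super)solution at `x`. -/
noncomputable def statOp {N : ℕ} (h : Euc N → ℝ) (lam m : ℝ)
    (φ : Euc N → ℝ) (r : ℝ) (x : Euc N) : ℝ :=
  -lapl φ x + ‖gradient φ x‖ ^ m + lam * r - h x

/-- Viscosity subsolution of the generalized Dirichlet problem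
`S(Ω,h,k,λ)`: `−Δw + |Dw|^m + λ w = h` in `Ω`, `w = k` on `∂Ω`. -/
def IsStatSub {N : ℕ} (Ω : Set (Euc N)) (h k : Euc N → ℝ) (lam m : ℝ)
    (u : Euc N → ℝ) : Prop :=
  UpperSemicontinuousOn u (closure Ω) ∧
  ∀ φ : Euc N → ℝ, ContDiff ℝ 2 φ → ∀ x₀ ∈ closure Ω,
    IsLocalMaxOn (u - φ) (closure Ω) x₀ →
      (x₀ ∈ Ω → statOp h lam m φ (u x₀) x₀ ≤ 0) ∧
      (x₀ ∈ frontier Ω → min (statOp h lam m φ (u x₀) x₀) (u x₀ - k x₀) ≤ 0)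

/-- Viscosity supersolution of the generalized Dirichlet problem `S(Ω,h,k,λ)`. -/
def IsStatSuper {N : ℕ} (Ω : Set (Euc N)) (h k : Euc N → ℝ) (lam m : ℝ)
    (v : Euc N → ℝ) : Prop :=
  LowerSemicontinuousOn v (closure Ω) ∧
  ∀ φ : Euc N → ℝ, ContDiff ℝ 2 φ → ∀ x₀ ∈ closure Ω,
    IsLocalMinOn (v - φ) (closure Ω) x₀ →
      (x₀ ∈ Ω → 0 ≤ statOp h lam m φ (v x₀) x₀) ∧
      (x₀ ∈ frontier Ω → 0 ≤ max (statOp h lam m φ (v x₀) x₀) (v x₀ - k x₀))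

/-- The parabolic operator
`φ_t(x,t) − Δφ(·,t)(x) + |Dφ(·,t)(x)|^m + λ r − f(x)`. -/
noncomputable def parOp {N : ℕ} (f : Euc N → ℝ) (lam m : ℝ)
    (φ : Euc N × ℝ → ℝ) (r : ℝ) (x : Euc N) (t : ℝ) : ℝ :=
  deriv (fun s => φ (x, s)) t - lapl (fun y => φ (y, t)) x
    + ‖gradient (fun y => φ (y, t)) x‖ ^ m + lam * r - f x

/-- Viscosity subsolution of the generalized initial-boundary value problem
`E(Ω,f,g,u₀,λ)` on the time interval `[0,T]`:
`u_t − Δu + |Du|^m + λ u = f` in `Ω × (0,T]`, `u = g` on `∂Ω × (0,T]`,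
`u(·,0) = u₀` on `closure Ω`. -/
def IsParSub {N : ℕ} (Ω : Set (Euc N)) (f g u₀ : Euc N → ℝ) (lam m T : ℝ)
    (u : Euc N → ℝ → ℝ) : Prop :=
  UpperSemicontinuousOn (fun p : Euc N × ℝ => u p.1 p.2) (closure Ω ×ˢ Ico 0 T) ∧
  (∀ x ∈ closure Ω, u x 0 ≤ u₀ x) ∧
  ∀ φ : Euc N × ℝ → ℝ, ContDiff ℝ 2 φ → ∀ x₀ : Euc N, ∀ t₀ : ℝ,
    (x₀, t₀) ∈ closure Ω ×ˢ Ioc 0 T →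
    IsLocalMaxOn (fun p : Euc N × ℝ => u p.1 p.2 - φ p) (closure Ω ×ˢ Ioc 0 T) (x₀, t₀) →
      (x₀ ∈ Ω → parOp f lam m φ (u x₀ t₀) x₀ t₀ ≤ 0) ∧
      (x₀ ∈ frontier Ω →
        min (parOp f lam m φ (u x₀ t₀) x₀ t₀) (u x₀ t₀ - g x₀) ≤ 0)

/-- Viscosity supersolution of `E(Ω,f,g,u₀,λ)` on the time interval `[0,T]`. -/
def IsParSuper {N : ℕ} (Ω : Set (Euc N)) (f g u₀ : Euc N → ℝ) (lam m T : ℝ)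
    (v : Euc N → ℝ → ℝ) : Prop :=
  LowerSemicontinuousOn (fun p : Euc N × ℝ => v p.1 p.2) (closure Ω ×ˢ Icc 0 T) ∧
  (∀ x ∈ closure Ω, u₀ x ≤ v x 0) ∧
  ∀ φ : Euc N × ℝ → ℝ, ContDiff ℝ 2 φ → ∀ x₀ : Euc N, ∀ t₀ : ℝ,
    (x₀, t₀) ∈ closure Ω ×ˢ Ioc 0 T →
    IsLocalMinOn (fun p : Euc N × ℝ => v p.1 p.2 - φ p) (closure Ω ×ˢ Ioc 0 T) (x₀, t₀) →
      (x₀ ∈ Ω → 0 ≤ parOp f lam m φ (v x₀ t₀) x₀ t₀) ∧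
      (x₀ ∈ frontier Ω →
        0 ≤ max (parOp f lam m φ (v x₀ t₀) x₀ t₀) (v x₀ t₀ - g x₀))

/-- A continuous viscosity solution, global in time, of `E(Ω,f,g,u₀,λ)`. -/
def IsGlobalParSol {N : ℕ} (Ω : Set (Euc N)) (f g u₀ : Euc N → ℝ) (lam m : ℝ)
    (u : Euc N → ℝ → ℝ) : Prop :=
  ContinuousOn (fun p : Euc N × ℝ => u p.1 p.2) (closure Ω ×ˢ Ici 0) ∧
  ∀ T > (0 : ℝ), IsParSub Ω f g u₀ lam m T u ∧ IsParSuper Ω f g u₀ lam m T u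

open scoped Classical in
/-- Redefinition of a parabolic subsolution on the lateral boundary by its
`limsup` from inside `Ω × (0,T]`. -/
noncomputable def uscExtPar {N : ℕ} (Ω : Set (Euc N)) (T : ℝ)
    (u : Euc N → ℝ → ℝ) : Euc N → ℝ → ℝ :=
  fun z t => if z ∈ Ω then u z t
    else limsup (fun p : Euc N × ℝ => u p.1 p.2) (𝓝[Ω ×ˢ Ioc 0 T] (z, t))

open scoped Classical in
/-- Redefinition of a stationary subsolution on the boundary by its `limsup`
from inside `Ω`. -/
noncomputable def uscExtStat {N : ℕ} (Ω : Set (Euc N))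
    (u : Euc N → ℝ) : Euc N → ℝ :=
  fun z => if z ∈ Ω then u z else limsup u (𝓝[Ω] z)

/-- Continuous viscosity solution of the state constraint problem
`−Δw + |Dw|^m + λ w = h` in `Ω`, `−Δw + |Dw|^m + λ w ≥ h` on `∂Ω`. -/
def IsSCSolution {N : ℕ} (Ω : Set (Euc N)) (h : Euc N → ℝ) (lam m : ℝ)
    (w : Euc N → ℝ) : Prop :=
  ContinuousOn w (closure Ω) ∧
  (∀ φ : Euc N → ℝ, ContDiff ℝ 2 φ → ∀ x₀ ∈ Ω, IsLocalMaxOn (w - φ) Ω x₀ →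
      statOp h lam m φ (w x₀) x₀ ≤ 0) ∧
  (∀ φ : Euc N → ℝ, ContDiff ℝ 2 φ → ∀ x₀ ∈ closure Ω,
      IsLocalMinOn (w - φ) (closure Ω) x₀ → 0 ≤ statOp h lam m φ (w x₀) x₀)

/-- Continuous viscosity subsolution of `−Δu + |Du|^m ≤ h` in `Ω`
(no boundary condition). -/
def IsIntSub {N : ℕ} (Ω : Set (Euc N)) (h : Euc N → ℝ) (m : ℝ)
    (u : Euc N → ℝ) : Prop :=
  ∀ φ : Euc N → ℝ, ContDiff ℝ 2 φ → ∀ x₀ ∈ Ω, IsLocalMaxOn (u - φ) Ω x₀ →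
    statOp h 0 m φ (u x₀) x₀ ≤ 0

/-- Hölder continuity with exponent `α` on a set. -/
def HolderOnCl {N : ℕ} (α : ℝ) (s : Set (Euc N)) (w : Euc N → ℝ) : Prop :=
  ∃ C > (0 : ℝ), ∀ x ∈ s, ∀ y ∈ s, |w x - w y| ≤ C * ‖x - y‖ ^ α

/-- Local Lipschitz continuity inside `Ω`. -/
def LocLipIn {N : ℕ} (Ω : Set (Euc N)) (w : Euc N → ℝ) : Prop :=
  ∀ x ∈ Ω, ∃ ε > (0 : ℝ), ∃ K : ℝ, 0 ≤ K ∧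
    ∀ y ∈ ball x ε ∩ Ω, ∀ z ∈ ball x ε ∩ Ω, |w y - w z| ≤ K * ‖y - z‖

/-- A piecewise `C¹` path parametrized on `[0,1]`. -/
def IsPWC1Path {N : ℕ} (γ : ℝ → Euc N) : Prop :=
  ContinuousOn γ (Icc 0 1) ∧
  ∃ n : ℕ, ∃ τ : Fin (n + 1) → ℝ, StrictMono τ ∧ τ 0 = 0 ∧ τ (Fin.last n) = 1 ∧
    ∀ i : Fin n, ContDiffOn ℝ 1 γ (Icc (τ i.castSucc) (τ i.succ))

/-- The length of a path on `[0,1]`. -/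
noncomputable def pathLen {N : ℕ} (γ : ℝ → Euc N) : ℝ :=
  ∫ t in (0 : ℝ)..1, ‖derivWithin γ (Icc (0 : ℝ) 1) t‖

/-- The geodesic-type distance inside `closure S` via piecewise `C¹` paths. -/
noncomputable def dTilde {N : ℕ} (S : Set (Euc N)) (x y : Euc N) : ℝ :=
  sInf {L : ℝ | ∃ γ : ℝ → Euc N, IsPWC1Path γ ∧ γ 0 = x ∧ γ 1 = y ∧
    MapsTo γ (Icc 0 1) (closure S) ∧ L = pathLen γ}

/-- The inner parallel set `Ω_δ = {x ∈ Ω : dist(x,∂Ω) > δ}`. -/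
def innerSet {N : ℕ} (Ω : Set (Euc N)) (δ : ℝ) : Set (Euc N) :=
  {x ∈ Ω | δ < infDist x (frontier Ω)}

end

open scoped InnerProductSpace Laplacian

theorem lapl_eq_laplacian {N : ℕ} (φ : Euc N → ℝ) : lapl φ = Δ φ := by
  rw [InnerProductSpace.laplacian_eq_iteratedFDeriv_orthonormalBasis φ
    (EuclideanSpace.basisFun (Fin N) ℝ)]
  ext x
  simp [lapl]

theorem lapl_congr {N : ℕ} {φ ψ : Euc N → ℝ} {x : Euc N} (h : φ =ᶠ[𝓝 x] ψ) :
    lapl φ x = lapl ψ x := by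
  simpa only [lapl_eq_laplacian] using
    (InnerProductSpace.laplacian_congr_nhds h).self_of_nhds

theorem gradient_congr {N : ℕ} {φ ψ : Euc N → ℝ} {x : Euc N} (h : φ =ᶠ[𝓝 x] ψ) :
    gradient φ x = gradient ψ x := by
  rw [gradient, gradient, h.fderiv_eq]

theorem lapl_add {N : ℕ} {φ ψ : Euc N → ℝ} {x : Euc N} (hφ : ContDiffAt ℝ 2 φ x)
    (hψ : ContDiffAt ℝ 2 ψ x) : lapl (fun y => φ y + ψ y) x = lapl φ x + lapl ψ x := by
  simp only [lapl_eq_laplacian]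
  exact hφ.laplacian_add hψ

theorem lapl_sub {N : ℕ} {φ ψ : Euc N → ℝ} {x : Euc N} (hφ : ContDiffAt ℝ 2 φ x)
    (hψ : ContDiffAt ℝ 2 ψ x) : lapl (fun y => φ y - ψ y) x = lapl φ x - lapl ψ x := by
  simp only [lapl_eq_laplacian]
  exact hφ.laplacian_sub hψ

theorem lapl_const_mul {N : ℕ} {φ : Euc N → ℝ} {x : Euc N} (c : ℝ) (hφ : ContDiffAt ℝ 2 φ x) :
    lapl (fun y => c * φ y) x = c * lapl φ x := by
  simp only [lapl_eq_laplacian]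
  exact InnerProductSpace.laplacian_smul c hφ

theorem lapl_neg {N : ℕ} (φ : Euc N → ℝ) (x : Euc N) :
    lapl (fun y => -φ y) x = -lapl φ x := by
  simp only [lapl_eq_laplacian]
  exact congrFun (InnerProductSpace.laplacian_neg (f := φ)) x

/-- The Laplacian read off from an explicit second derivative. -/
theorem lapl_eq_of_hasFDerivAt {N : ℕ} {φ : Euc N → ℝ} {x : Euc N}
    {g : Euc N → Euc N →L[ℝ] ℝ} {g' : Euc N →L[ℝ] Euc N →L[ℝ] ℝ}
    (hg : ∀ᶠ y in 𝓝 x, HasFDerivAt φ (g y) y) (hg' : HasFDerivAt g g' x) :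
    lapl φ x = ∑ i, g' (EuclideanSpace.single i 1) (EuclideanSpace.single i 1) := by
  have h1 : fderiv ℝ φ =ᶠ[𝓝 x] g := hg.mono fun y hy => hy.fderiv
  simp only [lapl, iteratedFDeriv_two_apply, h1.fderiv_eq, hg'.fderiv]
  simp

theorem continuous_lapl {N : ℕ} {φ : Euc N → ℝ} (hφ : ContDiff ℝ 2 φ) : Continuous (lapl φ) := by
  have h : Continuous (iteratedFDeriv ℝ 2 φ) := hφ.continuous_iteratedFDeriv le_rfl
  unfold lapl
  fun_prop

/-- Behaviour of the Laplacian under similarities. -/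
theorem lapl_comp_similarity {N : ℕ} {φ : Euc N → ℝ} (hφ : ContDiff ℝ 2 φ) (c : Euc N) (s : ℝ)
    (R : Euc N ≃ₗᵢ[ℝ] Euc N) (x : Euc N) :
    lapl (fun y => φ (c + s • R y)) x = s ^ 2 * lapl φ (c + s • R x) := by
  set A : Euc N →L[ℝ] Euc N := s • (R.toContinuousLinearEquiv : Euc N →L[ℝ] Euc N) with hA
  have hAf (y : Euc N) : HasFDerivAt (fun y => c + s • R y) A y := by
    have := A.hasFDerivAt (x := y) |>.const_add c
    exact this
  have hd : Differentiable ℝ φ := hφ.differentiable (by norm_num)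
  have hd2 : Differentiable ℝ (fderiv ℝ φ) :=
    (hφ.fderiv_right (m := 1) (by norm_num)).differentiable (by norm_num)
  have h1 (y : Euc N) : HasFDerivAt (fun y => φ (c + s • R y))
      ((fderiv ℝ φ (c + s • R y)).comp A) y := (hd _).hasFDerivAt.comp y (hAf y)
  have h2 : HasFDerivAt (fun y => (fderiv ℝ φ (c + s • R y)).comp A)
      (((ContinuousLinearMap.compL ℝ (Euc N) (Euc N) ℝ).flip A).comp
        ((fderiv ℝ (fderiv ℝ φ) (c + s • R x)).comp A)) x :=
    ((ContinuousLinearMap.compL ℝ (Euc N) (Euc N) ℝ).flip A).hasFDerivAt.comp x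
      ((hd2 _).hasFDerivAt.comp x (hAf x))
  rw [lapl_eq_of_hasFDerivAt (.of_forall h1) h2, lapl_eq_laplacian,
    InnerProductSpace.laplacian_eq_iteratedFDeriv_orthonormalBasis φ
      ((EuclideanSpace.basisFun (Fin N) ℝ).map R), Finset.mul_sum]
  refine Finset.sum_congr rfl fun i _ => ?_
  simp [iteratedFDeriv_two_apply, hA]
  ring

theorem gradient_comp_smul {N : ℕ} {φ : Euc N → ℝ} (hφ : Differentiable ℝ φ) (c : Euc N) (s : ℝ)
    (x : Euc N) : gradient (fun y => φ (c + s • y)) x = s • gradient φ (c + s • x) := by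
  have h : HasFDerivAt (fun y : Euc N => c + s • y) (s • ContinuousLinearMap.id ℝ (Euc N)) x :=
    ((hasFDerivAt_id x).const_smul s).const_add c
  have h2 := ((hφ _).hasFDerivAt.comp x h).fderiv
  simp only [Function.comp_def] at h2
  rw [gradient, gradient, h2]
  simp

theorem hasFDerivAt_radial {N : ℕ} {F : ℝ → ℝ} {F' : ℝ} (c : Euc N) {x : Euc N}
    (hF : HasDerivAt F F' (‖x - c‖ ^ 2)) :
    HasFDerivAt (fun y => F (‖y - c‖ ^ 2)) ((2 * F') • innerSL ℝ (x - c)) x := by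
  have h1 : HasFDerivAt (fun y : Euc N => ‖y - c‖ ^ 2) (2 • innerSL ℝ (x - c)) x := by
    simpa using ((hasFDerivAt_id x).sub_const c).norm_sq
  have h2 : F' • (2 • innerSL ℝ (x - c)) = (2 * F') • innerSL ℝ (x - c) := by
    rw [← Nat.cast_smul_eq_nsmul ℝ, smul_smul]
    push_cast
    rw [mul_comm]
  rw [← h2]
  exact hF.comp_hasFDerivAt x h1

theorem gradient_radial {N : ℕ} {F : ℝ → ℝ} {F' : ℝ} (c : Euc N) {x : Euc N}
    (hF : HasDerivAt F F' (‖x - c‖ ^ 2)) :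
    gradient (fun y => F (‖y - c‖ ^ 2)) x = (2 * F') • (x - c) := by
  rw [gradient, (hasFDerivAt_radial c hF).fderiv, map_smul]
  congr 1
  exact (InnerProductSpace.toDual ℝ (Euc N)).symm_apply_apply (x - c)

theorem sum_inner_single_sq {N : ℕ} (a : Euc N) :
    ∑ i, inner ℝ a (EuclideanSpace.single i 1) ^ 2 = ‖a‖ ^ 2 := by
  simp [EuclideanSpace.inner_single_right, EuclideanSpace.norm_sq_eq]

theorem lapl_radial {N : ℕ} {F F' : ℝ → ℝ} {F'' : ℝ} (c : Euc N) {x : Euc N}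
    (hF : ∀ᶠ t in 𝓝 (‖x - c‖ ^ 2), HasDerivAt F (F' t) t)
    (hF' : HasDerivAt F' F'' (‖x - c‖ ^ 2)) :
    lapl (fun y => F (‖y - c‖ ^ 2)) x = 4 * F'' * ‖x - c‖ ^ 2 + 2 * N * F' (‖x - c‖ ^ 2) := by
  have hc : Tendsto (fun y : Euc N => ‖y - c‖ ^ 2) (𝓝 x) (𝓝 (‖x - c‖ ^ 2)) :=
    Continuous.tendsto (by fun_prop) x
  have h1 : ∀ᶠ y in 𝓝 x, HasFDerivAt (fun y => F (‖y - c‖ ^ 2))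
      ((2 * F' (‖y - c‖ ^ 2)) • innerSL ℝ (y - c)) y :=
    (hc.eventually hF).mono fun y hy => hasFDerivAt_radial c hy
  have h2 := ((hasFDerivAt_radial c hF').const_mul 2).smul
    ((innerSL ℝ (E := Euc N)).hasFDerivAt.comp x ((hasFDerivAt_id x).sub_const c))
  rw [lapl_eq_of_hasFDerivAt h1 h2]
  have h3 : (2 : ℝ) * N * F' (‖x - c‖ ^ 2) = ∑ _i : Fin N, 2 * F' (‖x - c‖ ^ 2) := by
    simp; ring
  have h4 : 4 * F'' * ‖x - c‖ ^ 2 =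
      ∑ i : Fin N, 4 * F'' * inner ℝ (x - c) (EuclideanSpace.single i 1) ^ 2 := by
    rw [← sum_inner_single_sq, Finset.mul_sum]
  rw [h3, h4, ← Finset.sum_add_distrib]
  refine Finset.sum_congr rfl fun i _ => ?_
  have h5 : inner ℝ (EuclideanSpace.single i (1 : ℝ)) (EuclideanSpace.single i (1 : ℝ)) =
      (1 : ℝ) := by
    simp
  change 2 * F' (‖x - c‖ ^ 2) *
      inner ℝ (EuclideanSpace.single i (1 : ℝ)) (EuclideanSpace.single i (1 : ℝ)) +
    2 * (2 * F'' * inner ℝ (x - c) (EuclideanSpace.single i 1)) *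
      inner ℝ (x - c) (EuclideanSpace.single i 1) = _
  rw [h5]
  ring

/-- The Laplacian of a function of one linear coordinate. -/
theorem lapl_ridge {N : ℕ} {k k' : ℝ → ℝ} {k'' : ℝ} (a : Euc N) {x : Euc N} {b : ℝ}
    (hk : ∀ᶠ t in 𝓝 (b + inner ℝ a x), HasDerivAt k (k' t) t)
    (hk' : HasDerivAt k' k'' (b + inner ℝ a x)) :
    lapl (fun y => k (b + inner ℝ a y)) x = ‖a‖ ^ 2 * k'' := by
  have hd (y : Euc N) : HasFDerivAt (fun y => b + inner ℝ a y) (innerSL ℝ a) y :=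
    (innerSL ℝ a).hasFDerivAt.const_add b
  have hc : Tendsto (fun y : Euc N => b + inner ℝ a y) (𝓝 x) (𝓝 (b + inner ℝ a x)) :=
    (hd x).continuousAt
  have h1 : ∀ᶠ y in 𝓝 x, HasFDerivAt (fun y => k (b + inner ℝ a y))
      (k' (b + inner ℝ a y) • innerSL ℝ a) y :=
    (hc.eventually hk).mono fun y hy => hy.comp_hasFDerivAt y (hd y)
  have h2 := (hk'.comp_hasFDerivAt x (hd x)).smul_const (innerSL ℝ a)
  rw [lapl_eq_of_hasFDerivAt h1 h2, ← sum_inner_single_sq, Finset.sum_mul]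
  refine Finset.sum_congr rfl fun i _ => ?_
  simp
  ring

theorem deriv_deriv_nonpos_of_isLocalMax {k : ℝ → ℝ} {t : ℝ} (hk : ContinuousAt k t)
    (h : IsLocalMax k t) : deriv (deriv k) t ≤ 0 := by
  by_contra! hpos
  have hmin := isLocalMin_of_deriv_deriv_pos hpos h.deriv_eq_zero hk
  have hc : k =ᶠ[𝓝 t] fun _ => k t := by
    filter_upwards [h, hmin] with s h1 h2 using le_antisymm h1 h2
  have : deriv (deriv k) t = 0 := by
    have h1 : deriv k =ᶠ[𝓝 t] fun _ => 0 := by simpa using hc.deriv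
    simpa using h1.deriv_eq
  linarith

theorem lapl_nonpos_of_isLocalMax {N : ℕ} {φ : Euc N → ℝ} {x : Euc N} (hφ : ContDiffAt ℝ 2 φ x)
    (h : IsLocalMax φ x) : lapl φ x ≤ 0 := by
  refine Finset.sum_nonpos fun i _ => ?_
  set e : Euc N := EuclideanSpace.single i 1
  have hl (t : ℝ) : HasDerivAt (fun t : ℝ => x + t • e) e t := by
    simpa using ((hasDerivAt_id t).smul_const e).const_add x
  have hl0 : Tendsto (fun t : ℝ => x + t • e) (𝓝 0) (𝓝 x) := by
    simpa using (hl 0).continuousAt.tendsto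
  have hev : ∀ᶠ y in 𝓝 x, DifferentiableAt ℝ φ y :=
    (hφ.eventually (by simp)).mono fun y hy => hy.differentiableAt (by norm_num)
  have h1 : deriv (fun t : ℝ => φ (x + t • e)) =ᶠ[𝓝 0] fun t => fderiv ℝ φ (x + t • e) e :=
    (hl0.eventually hev).mono fun t ht => (ht.hasFDerivAt.comp_hasDerivAt t (hl t)).deriv
  have hd2 : DifferentiableAt ℝ (fderiv ℝ φ) (x + (0 : ℝ) • e) := by
    simpa using (hφ.fderiv_right (m := 1) (by norm_num)).differentiableAt (by norm_num)
  have h2 : deriv (deriv (fun t : ℝ => φ (x + t • e))) 0 = fderiv ℝ (fderiv ℝ φ) x e e := by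
    rw [h1.deriv_eq]
    have h3 := (hd2.hasFDerivAt.comp_hasDerivAt (0 : ℝ) (hl 0))
    have h4 := ((ContinuousLinearMap.apply ℝ ℝ e).hasFDerivAt.comp_hasDerivAt (0 : ℝ) h3).deriv
    rw [zero_smul, add_zero] at h4
    exact h4
  rw [iteratedFDeriv_two_apply]
  simp only [Matrix.cons_val_zero, Matrix.cons_val_one]
  rw [← h2]
  refine deriv_deriv_nonpos_of_isLocalMax ?_ ?_
  · exact ContinuousAt.comp (by simpa using hφ.continuousAt) (hl 0).continuousAt
  · have := hl0.eventually h
    simpa [IsLocalMax, IsMaxFilter] using this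

/-- A function that is `C²` at a point agrees near that point with a globally `C²` function. -/
theorem exists_contDiff_eventuallyEq {E : Type*} [NormedAddCommGroup E]
    [NormedSpace ℝ E] [FiniteDimensional ℝ E] {φ : E → ℝ} {x : E} (hφ : ContDiffAt ℝ 2 φ x) :
    ∃ ψ : E → ℝ, ContDiff ℝ 2 ψ ∧ ψ =ᶠ[𝓝 x] φ := by
  obtain ⟨ε, hε, hball⟩ := Metric.eventually_nhds_iff_ball.1 (hφ.eventually (by simp))
  let χ : ContDiffBump x := ⟨ε / 4, ε / 2, by positivity, by linarith⟩
  refine ⟨fun y => χ y * φ y, contDiff_iff_contDiffAt.2 fun y => ?_, ?_⟩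
  · by_cases hy : y ∈ ball x ε
    · exact χ.contDiff.contDiffAt.mul (hball y hy)
    · have hy' : ε ≤ dist y x := by simpa using hy
      have : (fun y => χ y * φ y) =ᶠ[𝓝 y] fun _ => 0 := by
        have ho : {z | ε / 2 < dist z x} ∈ 𝓝 y :=
          (isOpen_lt continuous_const (continuous_id.dist continuous_const)).mem_nhds
            (by change ε / 2 < dist y x; linarith)
        filter_upwards [ho] with z hz
        rw [χ.zero_of_le_dist (le_of_lt hz), zero_mul]
      exact contDiffAt_const.congr_of_eventuallyEq this
  · filter_upwards [χ.eventuallyEq_one] with y hy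
    simp [hy]

theorem contDiff_norm_sub_sq {N : ℕ} (c : Euc N) : ContDiff ℝ 2 (fun y : Euc N => ‖y - c‖ ^ 2) :=
  (contDiff_id.sub contDiff_const).norm_sq ℝ

theorem lapl_const_mul_norm_sub_sq {N : ℕ} (a : ℝ) (c x : Euc N) :
    lapl (fun y => a * ‖y - c‖ ^ 2) x = 2 * N * a := by
  have h := lapl_radial (F := fun t => a * t) (F' := fun _ => a) (F'' := 0) c (x := x)
    (.of_forall fun t => by simpa using (hasDerivAt_id t).const_mul a) (hasDerivAt_const _ _)
  rw [h]
  ring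

theorem le_of_lapl_pos {N : ℕ} {φ : Euc N → ℝ} (hφ : ContDiff ℝ 2 φ) {c : Euc N} {r M : ℝ}
    (hpos : ∀ x ∈ ball c r, 0 < lapl φ x) (hM : ∀ x ∈ sphere c r, φ x ≤ M) :
    ∀ x ∈ closedBall c r, φ x ≤ M := by
  intro x hx
  obtain ⟨z, hz, hmax⟩ := (isCompact_closedBall c r).exists_isMaxOn ⟨x, hx⟩
    hφ.continuous.continuousOn
  refine (hmax hx).trans ?_
  rcases (mem_closedBall.1 hz).lt_or_eq with h | h
  · have hloc : IsLocalMax φ z := by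
      filter_upwards [isOpen_ball.mem_nhds (mem_ball.2 h)] with y hy
      exact hmax (ball_subset_closedBall hy)
    exact absurd (lapl_nonpos_of_isLocalMax hφ.contDiffAt hloc) (hpos z h).not_ge
  · exact hM z h

/-- The weak maximum principle for `C²` subharmonic functions on balls. -/
theorem le_of_lapl_nonneg {N : ℕ} (hN : 1 ≤ N) {φ : Euc N → ℝ} (hφ : ContDiff ℝ 2 φ) {c : Euc N}
    {r M : ℝ} (hpos : ∀ x ∈ ball c r, 0 ≤ lapl φ x) (hM : ∀ x ∈ sphere c r, φ x ≤ M) :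
    ∀ x ∈ closedBall c r, φ x ≤ M := by
  intro x hx
  have hN' : (0 : ℝ) < N := by exact_mod_cast hN
  have key (ε : ℝ) (hε : 0 < ε) : φ x ≤ M + ε * r ^ 2 := by
    have hq : ContDiff ℝ 2 (fun y : Euc N => ε * ‖y - c‖ ^ 2) :=
      contDiff_const.mul (contDiff_norm_sub_sq c)
    have h := le_of_lapl_pos (hφ.add hq) (c := c) (r := r) (M := M + ε * r ^ 2) ?_ ?_ x hx
    · have : 0 ≤ ε * ‖x - c‖ ^ 2 := by positivity
      linarith
    · intro y hy
      rw [lapl_add hφ.contDiffAt hq.contDiffAt, lapl_const_mul_norm_sub_sq]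
      have := hpos y hy
      positivity
    · intro y hy
      have h1 := hM y hy
      rw [mem_sphere_iff_norm] at hy
      simp only [hy]
      linarith
  have ht : Tendsto (fun ε : ℝ => M + ε * r ^ 2) (𝓝[>] 0) (𝓝 M) := by
    have : Tendsto (fun ε : ℝ => M + ε * r ^ 2) (𝓝 0) (𝓝 (M + 0 * r ^ 2)) :=
      Continuous.tendsto (by fun_prop) 0
    simpa using this.mono_left nhdsWithin_le_nhds
  exact ge_of_tendsto ht (eventually_nhdsWithin_of_forall fun ε hε => key ε hε)

/-- The polynomial function on `ℝ^N` attached to a polynomial in `N` variables. -/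
noncomputable def polyFun {N : ℕ} (p : MvPolynomial (Fin N) ℝ) (x : Euc N) : ℝ :=
  MvPolynomial.eval (fun i => x i) p

/-- The formal Laplacian of a polynomial. -/
noncomputable def polyLapl (N : ℕ) : MvPolynomial (Fin N) ℝ →ₗ[ℝ] MvPolynomial (Fin N) ℝ :=
  ∑ i, (MvPolynomial.pderiv i).toLinearMap ∘ₗ (MvPolynomial.pderiv i).toLinearMap

theorem polyLapl_apply {N : ℕ} (p : MvPolynomial (Fin N) ℝ) :
    polyLapl N p = ∑ i, MvPolynomial.pderiv i (MvPolynomial.pderiv i p) := by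
  simp [polyLapl]

theorem polyFun_C {N : ℕ} (a : ℝ) : polyFun (N := N) (MvPolynomial.C a) = fun _ => a := by
  ext; simp [polyFun]

theorem polyFun_add {N : ℕ} (p q : MvPolynomial (Fin N) ℝ) :
    polyFun (p + q) = fun x => polyFun p x + polyFun q x := by
  ext; simp [polyFun]

theorem polyFun_mul_X {N : ℕ} (p : MvPolynomial (Fin N) ℝ) (i : Fin N) :
    polyFun (p * MvPolynomial.X i) = fun x => polyFun p x * x i := by
  ext; simp [polyFun]

theorem contDiff_polyFun {N : ℕ} (p : MvPolynomial (Fin N) ℝ) : ContDiff ℝ 2 (polyFun p) := by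
  induction p using MvPolynomial.induction_on with
  | C a => rw [polyFun_C]; exact contDiff_const
  | add p q hp hq => rw [polyFun_add]; exact hp.add hq
  | mul_X p i hp =>
    rw [polyFun_mul_X]
    exact hp.mul (EuclideanSpace.proj i : Euc N →L[ℝ] ℝ).contDiff

theorem hasFDerivAt_polyFun {N : ℕ} (p : MvPolynomial (Fin N) ℝ) (x : Euc N) :
    HasFDerivAt (polyFun p) (∑ i, polyFun (MvPolynomial.pderiv i p) x •
      (EuclideanSpace.proj i : Euc N →L[ℝ] ℝ)) x := by
  induction p using MvPolynomial.induction_on with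
  | C a =>
    have h : (∑ i, polyFun (MvPolynomial.pderiv i (MvPolynomial.C a)) x •
      (EuclideanSpace.proj i : Euc N →L[ℝ] ℝ)) = 0 := by simp [polyFun]
    rw [h, polyFun_C]
    exact hasFDerivAt_const a x
  | add p q hp hq =>
    have h : (∑ i, polyFun (MvPolynomial.pderiv i (p + q)) x •
        (EuclideanSpace.proj i : Euc N →L[ℝ] ℝ)) = (∑ i, polyFun (MvPolynomial.pderiv i p) x •
        (EuclideanSpace.proj i : Euc N →L[ℝ] ℝ)) + ∑ i, polyFun (MvPolynomial.pderiv i q) x •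
        (EuclideanSpace.proj i : Euc N →L[ℝ] ℝ) := by
      simp only [polyFun, map_add, add_smul, Finset.sum_add_distrib]
    rw [h, polyFun_add]
    exact hp.add hq
  | mul_X p j hp =>
    have h : HasFDerivAt (fun x : Euc N => x j) (EuclideanSpace.proj j : Euc N →L[ℝ] ℝ) x :=
      (EuclideanSpace.proj j : Euc N →L[ℝ] ℝ).hasFDerivAt
    have h3 : (∑ i, polyFun (MvPolynomial.pderiv i (p * MvPolynomial.X j)) x •
        (EuclideanSpace.proj i : Euc N →L[ℝ] ℝ)) =
          polyFun p x • (EuclideanSpace.proj j : Euc N →L[ℝ] ℝ) +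
          x j • ∑ i, polyFun (MvPolynomial.pderiv i p) x •
            (EuclideanSpace.proj i : Euc N →L[ℝ] ℝ) := by
      simp only [polyFun, MvPolynomial.pderiv_mul, map_add, map_mul, MvPolynomial.eval_X,
        MvPolynomial.pderiv_X, add_smul, Finset.sum_add_distrib, Finset.smul_sum, smul_smul]
      rw [add_comm]
      congr 1
      · rw [Finset.sum_eq_single j]
        · simp
        · intro b _ hb
          simp [hb.symm]
        · simp
      · exact Finset.sum_congr rfl fun i _ => by rw [mul_comm]
    rw [h3, polyFun_mul_X]
    exact hp.mul h

theorem lapl_polyFun {N : ℕ} (p : MvPolynomial (Fin N) ℝ) (x : Euc N) :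
    lapl (polyFun p) x = polyFun (polyLapl N p) x := by
  have h2 := HasFDerivAt.fun_sum (u := Finset.univ) fun i (_ : i ∈ Finset.univ) =>
    (hasFDerivAt_polyFun (MvPolynomial.pderiv i p) x).smul_const
      (EuclideanSpace.proj i : Euc N →L[ℝ] ℝ)
  rw [lapl_eq_of_hasFDerivAt (.of_forall (hasFDerivAt_polyFun p)) h2, polyLapl_apply]
  simp [polyFun]

theorem totalDegree_pderiv_le {σ : Type*} {k : ℕ} (i : σ) {p : MvPolynomial σ ℝ}
    (hp : p.totalDegree ≤ k + 1) : (MvPolynomial.pderiv i p).totalDegree ≤ k := by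
  classical
  rw [p.as_sum, map_sum]
  refine MvPolynomial.totalDegree_finsetSum_le fun s hs => ?_
  rw [MvPolynomial.pderiv_monomial]
  by_cases hi : s i = 0
  · simp [hi]
  refine (MvPolynomial.totalDegree_monomial_le _ _).trans ?_
  have h1 : (s.sum fun _ e => e) ≤ k + 1 := (MvPolynomial.le_totalDegree hs).trans hp
  have h2 : s - Finsupp.single i 1 + Finsupp.single i 1 = s :=
    tsub_add_cancel_of_le (Finsupp.single_le_iff.2 (Nat.one_le_iff_ne_zero.2 hi))
  have h3 := congrArg (fun t : σ →₀ ℕ => t.sum fun _ e => e) h2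
  rw [Finsupp.sum_add_index' (by simp) (by simp), Finsupp.sum_single_index rfl] at h3
  change ((s - Finsupp.single i 1).sum fun _ e => e) ≤ k
  omega

/-- The polynomial `r² - |X|²`, vanishing on the sphere of radius `r`. -/
noncomputable def spherePoly (N : ℕ) (r : ℝ) : MvPolynomial (Fin N) ℝ :=
  MvPolynomial.C (r ^ 2) - ∑ i, MvPolynomial.X i ^ 2

theorem polyFun_spherePoly {N : ℕ} (r : ℝ) (x : Euc N) :
    polyFun (spherePoly N r) x = r ^ 2 - ‖x‖ ^ 2 := by
  simp [polyFun, spherePoly, EuclideanSpace.norm_sq_eq]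

theorem totalDegree_spherePoly_mul_le {N k : ℕ} (r : ℝ) {q : MvPolynomial (Fin N) ℝ}
    (hq : q.totalDegree ≤ k) : (spherePoly N r * q).totalDegree ≤ k + 1 + 1 := by
  have h : (spherePoly N r).totalDegree ≤ 2 := by
    refine (MvPolynomial.totalDegree_sub _ _).trans (max_le (by
      rw [MvPolynomial.totalDegree_C]; omega) ?_)
    exact MvPolynomial.totalDegree_finsetSum_le fun i _ => (MvPolynomial.totalDegree_X_pow i 2).le
  have := MvPolynomial.totalDegree_mul (spherePoly N r) q
  omega

theorem totalDegree_polyLapl_le {N k : ℕ} {p : MvPolynomial (Fin N) ℝ}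
    (hp : p.totalDegree ≤ k + 1 + 1) : (polyLapl N p).totalDegree ≤ k := by
  rw [polyLapl_apply]
  exact MvPolynomial.totalDegree_finsetSum_le fun i _ =>
    totalDegree_pderiv_le i (totalDegree_pderiv_le i hp)

theorem eq_zero_of_polyLapl_spherePoly_mul {N : ℕ} (hN : 1 ≤ N) {r : ℝ} (hr : 0 < r)
    {q : MvPolynomial (Fin N) ℝ} (hq : polyLapl N (spherePoly N r * q) = 0) : q = 0 := by
  have hmul (q : MvPolynomial (Fin N) ℝ) (x : Euc N) :
      polyFun (spherePoly N r * q) x = (r ^ 2 - ‖x‖ ^ 2) * polyFun q x := by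
    rw [← polyFun_spherePoly]; simp [polyFun]
  have key (q : MvPolynomial (Fin N) ℝ) (hq : polyLapl N (spherePoly N r * q) = 0) :
      ∀ x ∈ closedBall (0 : Euc N) r, (r ^ 2 - ‖x‖ ^ 2) * polyFun q x ≤ 0 := by
    intro x hx
    rw [← hmul]
    refine le_of_lapl_nonneg hN (contDiff_polyFun _) (c := 0) (r := r) ?_ ?_ x hx
    · intro y _
      rw [lapl_polyFun, hq]
      simp [polyFun]
    · intro y hy
      rw [hmul, mem_sphere_zero_iff_norm.1 hy]
      simp
  have hzero (x : Euc N) (hx : x ∈ ball (0 : Euc N) r) : polyFun q x = 0 := by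
    have h1 := key q hq x (ball_subset_closedBall hx)
    have h2 := key (-q) (by rw [mul_neg, map_neg, hq, neg_zero]) x (ball_subset_closedBall hx)
    have h3 : polyFun (-q) x = -polyFun q x := by simp [polyFun]
    rw [h3] at h2
    have h4 : 0 < r ^ 2 - ‖x‖ ^ 2 := by
      have : ‖x‖ < r := mem_ball_zero_iff.1 hx
      nlinarith [norm_nonneg x]
    have h5 : (r ^ 2 - ‖x‖ ^ 2) * polyFun q x = 0 := by linarith
    exact (mul_eq_zero.1 h5).resolve_left h4.ne'
  obtain ⟨δ, hδ, hbox⟩ : ∃ δ > 0, ∀ y : Fin N → ℝ, (∀ i, y i ∈ Ioo (-δ) δ) →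
      WithLp.toLp 2 y ∈ ball (0 : Euc N) r := by
    have hcont : Continuous (fun y : Fin N → ℝ => (WithLp.toLp 2 y : Euc N)) :=
      PiLp.continuous_toLp 2 _
    have hnhds : ∀ᶠ y in 𝓝 (0 : Fin N → ℝ), WithLp.toLp 2 y ∈ ball (0 : Euc N) r :=
      hcont.continuousAt.eventually_mem (by
        simpa using ball_mem_nhds (0 : Euc N) hr)
    obtain ⟨δ, hδ, h⟩ := Metric.eventually_nhds_iff_ball.1 hnhds
    refine ⟨δ, hδ, fun y hy => h y ?_⟩
    rw [mem_ball_zero_iff, pi_norm_lt_iff hδ]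
    exact fun i => abs_lt.2 (hy i)
  refine MvPolynomial.funext_set (fun _ : Fin N => Ioo (-δ) δ)
    (fun _ => Ioo_infinite (by linarith)) fun y hy => ?_
  rw [map_zero]
  exact hzero _ (hbox y fun i => hy i (mem_univ i))

/-- A polynomial agrees on each sphere centred at the origin with a harmonic polynomial. -/
theorem exists_harmonic_poly {N : ℕ} (hN : 1 ≤ N) {r : ℝ} (hr : 0 < r)
    (p : MvPolynomial (Fin N) ℝ) : ∃ h : MvPolynomial (Fin N) ℝ, polyLapl N h = 0 ∧
      ∀ x ∈ sphere (0 : Euc N) r, polyFun h x = polyFun p x := by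
  set k := p.totalDegree
  let V := MvPolynomial.restrictTotalDegree (Fin N) ℝ k
  let T₀ : MvPolynomial (Fin N) ℝ →ₗ[ℝ] MvPolynomial (Fin N) ℝ :=
    polyLapl N ∘ₗ LinearMap.mulLeft ℝ (spherePoly N r)
  have hT₀ : ∀ q ∈ V, T₀ q ∈ V := fun q hq => by
    rw [MvPolynomial.mem_restrictTotalDegree] at hq ⊢
    exact totalDegree_polyLapl_le (totalDegree_spherePoly_mul_le r hq)
  let T : V →ₗ[ℝ] V := T₀.restrict hT₀
  have hinj : Function.Injective T := by
    rw [← LinearMap.ker_eq_bot, LinearMap.ker_eq_bot']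
    intro q hq
    have h1 : T₀ q = 0 := congrArg Subtype.val hq
    exact Subtype.ext (eq_zero_of_polyLapl_spherePoly_mul hN hr h1)
  obtain ⟨q, hq⟩ := LinearMap.injective_iff_surjective.1 hinj
    ⟨polyLapl N p, (MvPolynomial.mem_restrictTotalDegree _ _ _).2
      (totalDegree_polyLapl_le (by omega))⟩
  have hq' : polyLapl N (spherePoly N r * q) = polyLapl N p := congrArg Subtype.val hq
  refine ⟨p - spherePoly N r * (q : MvPolynomial (Fin N) ℝ), by rw [map_sub, hq', sub_self],
    fun x hx => ?_⟩
  have h2 : polyFun (p - spherePoly N r * (q : MvPolynomial (Fin N) ℝ)) x =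
      polyFun p x - polyFun (spherePoly N r) x * polyFun (q : MvPolynomial (Fin N) ℝ) x := by
    simp [polyFun]
  rw [h2, polyFun_spherePoly, mem_sphere_zero_iff_norm.1 hx]
  ring

/-- Continuous functions are uniform limits, on spheres, of harmonic functions. -/
theorem exists_harmonic_near {N : ℕ} (hN : 1 ≤ N) {r : ℝ} (hr : 0 < r) {F : Euc N → ℝ}
    (hF : Continuous F) {ε : ℝ} (hε : 0 < ε) : ∃ h : Euc N → ℝ, ContDiff ℝ 2 h ∧
      (∀ x, lapl h x = 0) ∧ ∀ x ∈ sphere (0 : Euc N) r, |h x - F x| < ε := by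
  let X : Fin N → C(Euc N, ℝ) := fun i => ⟨fun x => x i, by fun_prop⟩
  let A : Subalgebra ℝ C(Euc N, ℝ) := (MvPolynomial.aeval X).range
  have hA (p : MvPolynomial (Fin N) ℝ) (x : Euc N) :
      (MvPolynomial.aeval X p : C(Euc N, ℝ)) x = polyFun p x := by
    induction p using MvPolynomial.induction_on with
    | C a => simp [polyFun]
    | add p q hp hq => simp_all [polyFun]
    | mul_X p i hp => simp_all [polyFun, X]
  have hsep : A.SeparatesPoints := by
    intro x y hxy
    obtain ⟨i, hi⟩ : ∃ i, x i ≠ y i := by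
      by_contra! h
      exact hxy (by ext i; exact h i)
    exact ⟨X i, ⟨X i, ⟨MvPolynomial.X i, by simp⟩, rfl⟩, hi⟩
  obtain ⟨g, ⟨p, rfl⟩, hg⟩ :=
    ContinuousMap.exists_mem_subalgebra_near_continuous_of_isCompact_of_separatesPoints hsep
      ⟨F, hF⟩ (isCompact_sphere (0 : Euc N) r) hε
  obtain ⟨h, hh, hhp⟩ := exists_harmonic_poly hN hr p
  refine ⟨polyFun h, contDiff_polyFun h, fun x => ?_, fun x hx => ?_⟩
  · rw [lapl_polyFun, hh]
    simp [polyFun]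
  · rw [hhp x hx, ← hA]
    exact hg x hx

theorem lapl_const {N : ℕ} (c : ℝ) (x : Euc N) : lapl (fun _ => c) x = 0 := by
  rw [lapl_eq_of_hasFDerivAt (.of_forall fun y => hasFDerivAt_const c y) (hasFDerivAt_const 0 x)]
  simp

/-- `w` is a viscosity subsolution of `-Δw + H(Dw) ≤ K` in `U`. -/
def ViscSub {N : ℕ} (U : Set (Euc N)) (H : Euc N → ℝ) (K : ℝ) (w : Euc N → ℝ) : Prop :=
  ∀ φ : Euc N → ℝ, ContDiff ℝ 2 φ → ∀ x ∈ U, IsLocalMax (fun y => w y - φ y) x →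
    -lapl φ x + H (gradient φ x) ≤ K

theorem ViscSub.mono {N : ℕ} {U V : Set (Euc N)} {H : Euc N → ℝ} {K : ℝ} {w : Euc N → ℝ}
    (h : ViscSub U H K w) (hV : V ⊆ U) : ViscSub V H K w :=
  fun φ hφ x hx => h φ hφ x (hV hx)

/-- A continuous subsolution of `-Δw ≤ a` lies below, and on the boundary close to, a solution of
`-Δϕ = a'` when `a < a'`. -/
theorem ViscSub.exists_majorant {N : ℕ} (hN : 1 ≤ N) {W : Euc N → ℝ} (hW : Continuous W)
    {r a a' κ : ℝ} (hr : 0 < r) (hs : ViscSub (ball 0 r) (fun _ => 0) a W) (ha : a < a')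
    (hκ : 0 < κ) : ∃ ϕ : Euc N → ℝ, ContDiff ℝ 2 ϕ ∧ (∀ x, lapl ϕ x = -a') ∧
      (∀ x ∈ closedBall 0 r, W x ≤ ϕ x) ∧ ∀ x ∈ sphere 0 r, ϕ x ≤ W x + κ := by
  have hN' : (0 : ℝ) < N := by exact_mod_cast hN
  set b := a' / (2 * N)
  obtain ⟨h, hh, hlap, happ⟩ := exists_harmonic_near hN hr
    (F := fun x => W x + b * ‖x - 0‖ ^ 2) (by fun_prop) (half_pos hκ)
  have hq : ContDiff ℝ 2 (fun y : Euc N => b * ‖y - 0‖ ^ 2) :=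
    contDiff_const.mul (contDiff_norm_sub_sq 0)
  let ϕ : Euc N → ℝ := fun x => (h x - b * ‖x - 0‖ ^ 2) + κ / 2
  have hϕ : ContDiff ℝ 2 ϕ := (hh.sub hq).add contDiff_const
  have hϕl (x : Euc N) : lapl ϕ x = -a' := by
    rw [lapl_add (hh.sub hq).contDiffAt contDiffAt_const, lapl_sub hh.contDiffAt hq.contDiffAt,
      lapl_const_mul_norm_sub_sq, hlap, lapl_const]
    simp only [b]
    field_simp
    ring
  have hsph : ∀ x ∈ sphere (0 : Euc N) r, W x ≤ ϕ x ∧ ϕ x ≤ W x + κ := fun x hx => by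
    have := abs_lt.1 (happ x hx)
    simp only [ϕ]
    constructor <;> linarith [this.1, this.2]
  refine ⟨ϕ, hϕ, hϕl, fun x hx => ?_, fun x hx => (hsph x hx).2⟩
  obtain ⟨z, hz, hmax⟩ := (isCompact_closedBall (0 : Euc N) r).exists_isMaxOn ⟨x, hx⟩
    (hW.sub hϕ.continuous).continuousOn
  have h1 : W x - ϕ x ≤ W z - ϕ z := hmax hx
  rcases (mem_closedBall.1 hz).lt_or_eq with h | h
  · have hloc : IsLocalMax (fun y => W y - ϕ y) z := by
      filter_upwards [isOpen_ball.mem_nhds (mem_ball.2 h)] with y hy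
      exact hmax (ball_subset_closedBall hy)
    have := hs ϕ hϕ z h hloc
    rw [hϕl] at this
    linarith
  · linarith [(hsph z h).1]

/-- The sum of continuous viscosity subsolutions of `-ΔW ≤ a` and `-ΔY ≤ b` is a viscosity
subsolution of `-Δ(W + Y) ≤ a + b`. -/
theorem neg_lapl_le_of_isLocalMax_add {N : ℕ} (hN : 1 ≤ N) {W Y φ : Euc N → ℝ} (hW : Continuous W)
    (hY : Continuous Y) {ρ a b : ℝ} (hρ : 0 < ρ) (hWs : ViscSub (ball 0 ρ) (fun _ => 0) a W)
    (hYs : ViscSub (ball 0 ρ) (fun _ => 0) b Y) (hφ : ContDiff ℝ 2 φ)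
    (h : IsLocalMax (fun ξ => W ξ + Y ξ - φ ξ) 0) : -lapl φ 0 ≤ a + b := by
  by_contra! hlt
  have hN' : (0 : ℝ) < N := by exact_mod_cast hN
  set δ := (-lapl φ 0 - (a + b)) / 8 with hδ
  have hδ0 : 0 < δ := by simp only [hδ]; linarith
  have hcont : ∀ᶠ x in 𝓝 (0 : Euc N), a + b + 4 * δ < -lapl φ x :=
    (continuous_lapl hφ).neg.continuousAt.eventually_const_lt
      (by simp only [Pi.neg_apply]; linarith)
  obtain ⟨r₀, hr₀, hball⟩ := Metric.eventually_nhds_iff_ball.1 (hcont.and h)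
  set r := min ρ r₀ / 2
  have hr : 0 < r := by positivity
  have hrρ : r < ρ := (half_lt_self (by positivity)).trans_le (min_le_left _ _)
  have hrr : r < r₀ := (half_lt_self (by positivity)).trans_le (min_le_right _ _)
  set c := δ / N
  have hc : 0 < c := by positivity
  obtain ⟨ϕ₁, h₁, hl₁, hW₁, hs₁⟩ := (hWs.mono (ball_subset_ball hrρ.le)).exists_majorant hN hW hr
    (a' := a + δ) (κ := c * r ^ 2 / 4) (by linarith) (by positivity)
  obtain ⟨ϕ₂, h₂, hl₂, hY₂, hs₂⟩ := (hYs.mono (ball_subset_ball hrρ.le)).exists_majorant hN hY hr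
    (a' := b + δ) (κ := c * r ^ 2 / 4) (by linarith) (by positivity)
  have hq : ContDiff ℝ 2 (fun y : Euc N => c * ‖y - 0‖ ^ 2) :=
    contDiff_const.mul (contDiff_norm_sub_sq 0)
  have key := le_of_lapl_pos (φ := fun x => ((ϕ₁ x + ϕ₂ x) - φ x) - c * ‖x - 0‖ ^ 2)
    (((h₁.add h₂).sub hφ).sub hq) (c := 0) (r := r)
    (M := W 0 + Y 0 - φ 0 - c * r ^ 2 / 2) ?_ ?_ 0 (by simp [hr.le])
  · have h0 : (0 : Euc N) ∈ closedBall 0 r := by simp [hr.le]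
    have := hW₁ 0 h0
    have := hY₂ 0 h0
    have : 0 < c * r ^ 2 := by positivity
    simp only [sub_zero, norm_zero] at key
    nlinarith
  · intro x hx
    rw [lapl_sub ((h₁.add h₂).sub hφ).contDiffAt hq.contDiffAt, lapl_sub (h₁.add h₂).contDiffAt
      hφ.contDiffAt, lapl_add h₁.contDiffAt h₂.contDiffAt, lapl_const_mul_norm_sub_sq, hl₁, hl₂]
    have h1 := (hball x (ball_subset_ball hrr.le hx)).1
    have h2 : 2 * N * c = 2 * δ := by simp only [c]; field_simp
    linarith
  · intro x hx
    have h1 := (hball x (mem_ball.2 ((mem_sphere.1 hx).trans_lt hrr))).2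
    have h2 := hs₁ x hx
    have h3 := hs₂ x hx
    rw [mem_sphere_iff_norm] at hx
    simp only [hx]
    linarith

theorem gradient_eq_of_isLocalMax_sub {N : ℕ} {φ ψ : Euc N → ℝ} {x : Euc N}
    (hφ : DifferentiableAt ℝ φ x) (hψ : DifferentiableAt ℝ ψ x)
    (h : IsLocalMax (fun y => φ y - ψ y) x) : gradient φ x = gradient ψ x := by
  have h1 := h.fderiv_eq_zero
  rw [fderiv_fun_sub hφ hψ, sub_eq_zero] at h1
  rw [gradient, gradient, h1]

theorem gradient_neg_const_mul_norm_sub_sq {N : ℕ} (k : ℝ) (c x : Euc N) :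
    gradient (fun y => -(k * ‖y - c‖ ^ 2)) x = (2 * k) • (c - x) := by
  have h : HasDerivAt (fun t : ℝ => -(k * t)) (-k) (‖x - c‖ ^ 2) := by
    simpa using (hasDerivAt_mul_const (x := ‖x - c‖ ^ 2) (-k)).congr_of_eventuallyEq
      (.of_forall fun t => by ring)
  rw [gradient_radial c h, ← neg_sub c x, smul_neg, ← neg_smul]
  congr 1
  ring

/-- The sup-convolution of `w` over the closed ball of centre `c` and radius `r`. -/
noncomputable def supConv {N : ℕ} (w : Euc N → ℝ) (c : Euc N) (r k : ℝ) (x : Euc N) : ℝ :=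
  sSup ((fun x' => w x' - k * ‖x - x'‖ ^ 2) '' closedBall c r)

section SupConv

variable {N : ℕ} {w : Euc N → ℝ} {c : Euc N} {r k : ℝ}

theorem continuous_supConv (hw : Continuous w) : Continuous (supConv w c r k) :=
  (isCompact_closedBall c r).continuous_sSup
    (f := fun x x' => w x' - k * ‖x - x'‖ ^ 2) (by
      simp only [Function.HasUncurry.uncurry, id]; fun_prop)

theorem le_supConv (hw : Continuous w) (x : Euc N) {x' : Euc N} (hx' : x' ∈ closedBall c r) :
    w x' - k * ‖x - x'‖ ^ 2 ≤ supConv w c r k x :=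
  le_csSup ((isCompact_closedBall c r).bddAbove_image (by fun_prop)) (mem_image_of_mem _ hx')

theorem exists_supConv_eq (hw : Continuous w) (hr : 0 ≤ r) (x : Euc N) :
    ∃ x' ∈ closedBall c r, supConv w c r k x = w x' - k * ‖x - x'‖ ^ 2 :=
  (isCompact_closedBall c r).exists_sSup_image_eq ⟨c, by simpa using hr⟩ (by fun_prop)

/-- Near a point where the maximizer is unique and interior, the sup-convolution of a subsolution
of `-Δw + H(Dw) ≤ K` is a subsolution of the equation with frozen gradient. -/
theorem ViscSub.supConv {H : Euc N → ℝ} (hH : Continuous H) (hw : Continuous w) {K a : ℝ}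
    (hs : ViscSub (ball c r) H K w) {x₀ x₀' : Euc N} (hx₀' : x₀' ∈ ball c r)
    (huniq : ∀ x' ∈ closedBall c r, x' ≠ x₀' →
      w x' - k * ‖x₀ - x'‖ ^ 2 < w x₀' - k * ‖x₀ - x₀'‖ ^ 2)
    (ha : K - H ((2 * k) • (x₀' - x₀)) < a) :
    ∃ ρ > 0, ViscSub (ball x₀ ρ) (fun _ => 0) a (supConv w c r k) := by
  have hr : 0 ≤ r := (dist_nonneg.trans_lt (mem_ball.1 hx₀')).le
  have h1 : ∀ᶠ z : Euc N × Euc N in 𝓝 (x₀, x₀'),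
      K - H ((2 * k) • (z.2 - z.1)) < a ∧ z.2 ∈ ball c r := by
    refine Eventually.and ?_ ?_
    · exact ContinuousAt.eventually_lt (f := fun z : Euc N × Euc N =>
        K - H ((2 * k) • (z.2 - z.1))) (g := fun _ => a) (by fun_prop) (by fun_prop) ha
    · exact continuousAt_snd.eventually_mem (isOpen_ball.mem_nhds hx₀')
  rw [nhds_prod_eq] at h1
  obtain ⟨P, hP, Q, hQ, hPQ⟩ := eventually_prod_iff.1 h1
  obtain ⟨V, hVQ, hVo, hxV⟩ := _root_.mem_nhds_iff.1 hQ
  have h2 : ∀ᶠ x in 𝓝 x₀, ∀ x' ∈ closedBall c r \ V,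
      w x' - k * ‖x - x'‖ ^ 2 < w x₀' - k * ‖x - x₀'‖ ^ 2 := by
    refine ((isCompact_closedBall c r).diff hVo).eventually_forall_of_forall_eventually
      fun x' hx' => ?_
    refine ContinuousAt.eventually_lt (f := fun z : Euc N × Euc N => w z.2 - k * ‖z.1 - z.2‖ ^ 2)
      (g := fun z : Euc N × Euc N => w x₀' - k * ‖z.1 - x₀'‖ ^ 2) (by fun_prop) (by fun_prop) ?_
    exact huniq x' hx'.1 fun h => hx'.2 (h ▸ hxV)
  obtain ⟨ρ, hρ, hball⟩ := Metric.eventually_nhds_iff_ball.1 (hP.and h2)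
  refine ⟨ρ, hρ, fun θ hθ x hx hmax => ?_⟩
  obtain ⟨hPx, hVx⟩ := hball x hx
  obtain ⟨x', hx', hxx'⟩ := exists_supConv_eq (k := k) hw hr x
  have hx'V : x' ∈ V := by
    by_contra hn
    have := hVx x' ⟨hx', hn⟩
    have := le_supConv (k := k) hw x (ball_subset_closedBall hx₀')
    linarith
  obtain ⟨hlt, hx'b⟩ := hPQ hPx (hVQ hx'V)
  have hgrad : gradient θ x = (2 * k) • (x' - x) := by
    rw [← gradient_neg_const_mul_norm_sub_sq]
    refine (gradient_eq_of_isLocalMax_sub (φ := fun y => -(k * ‖y - x'‖ ^ 2)) ?_ ?_ ?_).symm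
    · exact ((contDiff_const.mul (contDiff_norm_sub_sq x')).neg.differentiable (by simp)) x
    · exact hθ.differentiable (by simp) x
    · filter_upwards [hmax] with y hy
      have := le_supConv (k := k) hw y hx'
      linarith
  have hcs := lapl_comp_similarity hθ (x - x') 1 (LinearIsometryEquiv.refl ℝ _) x'
  have hcg := gradient_comp_smul (hθ.differentiable (by simp)) (x - x') 1 x'
  simp only [one_smul, LinearIsometryEquiv.coe_refl, id, one_pow, one_mul, sub_add_cancel]
    at hcs hcg
  have hcd : ContDiff ℝ 2 (fun y => θ (x - x' + y)) :=
    hθ.comp (contDiff_const.add contDiff_id)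
  have hfin := hs _ hcd x' hx'b ?_
  · rw [hcs, hcg, hgrad] at hfin
    simp only at hlt
    linarith
  · have ht : Tendsto (fun y => x - x' + y) (𝓝 x') (𝓝 x) := by
      have : Tendsto (fun y => x - x' + y) (𝓝 x') (𝓝 (x - x' + x')) :=
        Continuous.tendsto (by fun_prop) x'
      simpa using this
    filter_upwards [ht.eventually hmax, isOpen_ball.mem_nhds hx'b] with y hy hyb
    have h3 := le_supConv (k := k) hw (x - x' + y) (ball_subset_closedBall hyb)
    rw [show x - x' + y - y = x - x' by abel] at h3
    simp only [sub_add_cancel]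
    linarith

end SupConv

theorem ViscSub.comp_isometry {N : ℕ} {W : Euc N → ℝ} {x : Euc N} {ρ a : ℝ}
    (h : ViscSub (ball x ρ) (fun _ => 0) a W) (R : Euc N ≃ₗᵢ[ℝ] Euc N) :
    ViscSub (ball 0 ρ) (fun _ => 0) a (fun ξ => W (x + R ξ)) := by
  intro φ hφ ξ hξ hmax
  have hl := lapl_comp_similarity hφ (-R.symm x) 1 R.symm (x + R ξ)
  simp only [one_smul, one_pow, one_mul, map_add, R.symm_apply_apply, neg_add_cancel_left] at hl
  have hcd : ContDiff ℝ 2 (fun y => φ (-R.symm x + R.symm y)) :=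
    hφ.comp (contDiff_const.add R.symm.toContinuousLinearEquiv.contDiff)
  have := h _ hcd (x + R ξ) ?_ ?_
  · rwa [hl] at this
  · rw [mem_ball_iff_norm, add_sub_cancel_left, R.norm_map]
    simpa using hξ
  · have ht : Tendsto (fun y => -R.symm x + R.symm y) (𝓝 (x + R ξ)) (𝓝 ξ) := by
      have : Tendsto (fun y => -R.symm x + R.symm y) (𝓝 (x + R ξ))
        (𝓝 (-R.symm x + R.symm (x + R ξ))) := Continuous.tendsto (by fun_prop) _
      simpa using this
    filter_upwards [ht.eventually hmax] with y hy
    simpa using hy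

theorem lapl_comp_affine {N : ℕ} {E : Type*} [NormedAddCommGroup E] [NormedSpace ℝ E] {φ : E → ℝ}
    (hφ : ContDiff ℝ 2 φ) (A : Euc N →L[ℝ] E) (z : E) :
    lapl (fun ξ => φ (z + A ξ)) 0 = ∑ i, fderiv ℝ (fderiv ℝ φ) z (A (EuclideanSpace.single i 1))
      (A (EuclideanSpace.single i 1)) := by
  have hAf (y : Euc N) : HasFDerivAt (fun y => z + A y) A y := A.hasFDerivAt.const_add z
  have hd : Differentiable ℝ φ := hφ.differentiable (by norm_num)
  have hd2 : Differentiable ℝ (fderiv ℝ φ) :=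
    (hφ.fderiv_right (m := 1) (by norm_num)).differentiable (by norm_num)
  have h1 (y : Euc N) : HasFDerivAt (fun y => φ (z + A y))
      ((fderiv ℝ φ (z + A y)).comp A) y := (hd _).hasFDerivAt.comp y (hAf y)
  have h2 : HasFDerivAt (fun y => (fderiv ℝ φ (z + A y)).comp A)
      (((ContinuousLinearMap.compL ℝ (Euc N) E ℝ).flip A).comp
        ((fderiv ℝ (fderiv ℝ φ) (z + A 0)).comp A)) 0 :=
    ((ContinuousLinearMap.compL ℝ (Euc N) E ℝ).flip A).hasFDerivAt.comp 0
      ((hd2 _).hasFDerivAt.comp 0 (hAf 0))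
  rw [lapl_eq_of_hasFDerivAt (.of_forall h1) h2]
  simp

section Product

variable {N : ℕ} {φ : Euc N × Euc N → ℝ}

theorem continuous_lapl_diagonal (hφ : ContDiff ℝ 2 φ) (R : Euc N ≃ₗᵢ[ℝ] Euc N) :
    Continuous fun z : Euc N × Euc N => lapl (fun ξ => φ (z.1 + ξ, z.2 + R ξ)) 0 := by
  have h2 : Continuous (fderiv ℝ (fderiv ℝ φ)) :=
    (hφ.fderiv_right (m := 1) (by norm_num)).continuous_fderiv (by norm_num)
  let A : Euc N →L[ℝ] Euc N × Euc N :=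
    (ContinuousLinearMap.id ℝ (Euc N)).prod (R.toContinuousLinearEquiv : Euc N →L[ℝ] Euc N)
  have h (z : Euc N × Euc N) := lapl_comp_affine hφ A z
  have h' : (fun z : Euc N × Euc N => lapl (fun ξ => φ (z.1 + ξ, z.2 + R ξ)) 0) =
      fun z => ∑ i, fderiv ℝ (fderiv ℝ φ) z (A (EuclideanSpace.single i 1))
        (A (EuclideanSpace.single i 1)) := funext h
  rw [h']
  fun_prop

theorem continuous_gradient_fst (hφ : ContDiff ℝ 2 φ) :
    Continuous fun z : Euc N × Euc N => gradient (fun x => φ (x, z.2)) z.1 := by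
  have h1 : Continuous (fderiv ℝ φ) := hφ.continuous_fderiv (by norm_num)
  have h2 (z : Euc N × Euc N) : fderiv ℝ (fun x => φ (x, z.2)) z.1 =
      (fderiv ℝ φ z).comp (ContinuousLinearMap.inl ℝ (Euc N) (Euc N)) :=
    ((hφ.differentiable (by norm_num) z).hasFDerivAt.comp z.1
      (hasFDerivAt_prodMk_left z.1 z.2)).fderiv
  unfold gradient
  simp only [h2]
  fun_prop

theorem continuous_gradient_snd (hφ : ContDiff ℝ 2 φ) :
    Continuous fun z : Euc N × Euc N => gradient (fun y => φ (z.1, y)) z.2 := by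
  have h1 : Continuous (fderiv ℝ φ) := hφ.continuous_fderiv (by norm_num)
  have h2 (z : Euc N × Euc N) : fderiv ℝ (fun y => φ (z.1, y)) z.2 =
      (fderiv ℝ φ z).comp (ContinuousLinearMap.inr ℝ (Euc N) (Euc N)) :=
    ((hφ.differentiable (by norm_num) z).hasFDerivAt.comp z.2
      (hasFDerivAt_prodMk_right z.1 z.2)).fderiv
  unfold gradient
  simp only [h2]
  fun_prop

end Product

/-- Points where a strongly penalized function is large are close to the diagonal maximum. -/
theorem eventually_penalized_lt {X : Type*} [TopologicalSpace X] {B : Set X} (hB : IsCompact B)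
    {G q : X × X → ℝ} (hG : Continuous G) (hq : Continuous q) (hq₀ : ∀ p, 0 ≤ q p)
    (hq₁ : ∀ p : X × X, p.1 ≠ p.2 → 0 < q p) {P : X} {M : ℝ}
    (hP : ∀ z ∈ B, z ≠ P → G (z, z) < M) {O : Set (X × X)} (hO : IsOpen O) (hPO : (P, P) ∈ O) :
    ∀ᶠ k : ℝ in atTop, ∀ p ∈ (B ×ˢ B) \ O, G p - k * q p < M := by
  have hK : IsCompact ((B ×ˢ B) \ O) := (hB.prod hB).diff hO
  have key : ∀ p₀ ∈ (B ×ˢ B) \ O,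
      {z : (X × X) × ℝ | G z.1 - z.2 * q z.1 < M} ∈ 𝓝 p₀ ×ˢ (atTop : Filter ℝ) := by
    rintro ⟨a, b⟩ ⟨⟨ha, -⟩, hpO⟩
    by_cases hab : a = b
    · subst hab
      have hne : a ≠ P := by rintro rfl; exact hpO hPO
      have h1 : ∀ᶠ p in 𝓝 (a, a), G p < M :=
        hG.continuousAt.eventually_lt continuousAt_const (hP a ha hne)
      filter_upwards [h1.prod_mk (eventually_ge_atTop (0 : ℝ))] with z hz
      have := mul_nonneg hz.2 (hq₀ z.1)
      show G z.1 - z.2 * q z.1 < M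
      linarith [hz.1]
    · have hpos := hq₁ (a, b) hab
      have h1 : ∀ᶠ p in 𝓝 (a, b), G p < G (a, b) + 1 ∧ q (a, b) / 2 < q p :=
        (hG.continuousAt.eventually_lt continuousAt_const (by linarith)).and
          (continuousAt_const.eventually_lt hq.continuousAt (by linarith))
      have h2 : ∀ᶠ k : ℝ in atTop, 0 ≤ k ∧ G (a, b) + 1 - M < k * (q (a, b) / 2) :=
        (eventually_ge_atTop 0).and
          ((tendsto_id.atTop_mul_const (half_pos hpos)).eventually_gt_atTop _)
      filter_upwards [h1.prod_mk h2] with z hz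
      have := mul_le_mul_of_nonneg_left hz.1.2.le hz.2.1
      show G z.1 - z.2 * q z.1 < M
      linarith [hz.1.1, hz.2.2]
  have h := hK.mem_nhdsSet_prod_of_forall key
  have h' : ∀ᶠ z in 𝓝ˢ ((B ×ˢ B) \ O) ×ˢ (atTop : Filter ℝ), G z.1 - z.2 * q z.1 < M := h
  have h3 : ∀ᶠ z in (atTop : Filter ℝ) ×ˢ 𝓝ˢ ((B ×ˢ B) \ O), G z.2 - z.1 * q z.2 < M :=
    Filter.eventually_swap_iff.2 h'
  exact h3.curry.mono fun k hk => hk.self_of_nhdsSet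

/-- Doubling of variables at a strict maximum point. -/
theorem doubling_of_strict {N : ℕ} (hN : 1 ≤ N) {w v : Euc N → ℝ} (hw : Continuous w)
    (hv : Continuous v) {U V : Set (Euc N)} {x₀ y₀ : Euc N} (hU : U ∈ 𝓝 x₀) (hV : V ∈ 𝓝 y₀)
    {H₁ H₂ : Euc N → ℝ} (hH₁ : Continuous H₁) (hH₂ : Continuous H₂) {K₁ K₂ : ℝ}
    (hws : ViscSub U H₁ K₁ w) (hvs : ViscSub V H₂ K₂ v) {φ : Euc N × Euc N → ℝ}
    (hφ : ContDiff ℝ 2 φ) (hmax : ∀ᶠ z : Euc N × Euc N in 𝓝 (x₀, y₀), z ≠ (x₀, y₀) →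
      w z.1 + v z.2 - φ z < w x₀ + v y₀ - φ (x₀, y₀)) (R : Euc N ≃ₗᵢ[ℝ] Euc N) :
    -lapl (fun ξ => φ (x₀ + ξ, y₀ + R ξ)) 0 + H₁ (gradient (fun x => φ (x, y₀)) x₀)
      + H₂ (gradient (fun y => φ (x₀, y)) y₀) ≤ K₁ + K₂ := by
  by_contra! hlt
  set L : Euc N × Euc N → ℝ := fun z => -lapl (fun ξ => φ (z.1 + ξ, z.2 + R ξ)) 0
    + H₁ (gradient (fun x => φ (x, z.2)) z.1) + H₂ (gradient (fun y => φ (z.1, y)) z.2) with hL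
  have hLc : Continuous L :=
    ((continuous_lapl_diagonal hφ R).neg.add (hH₁.comp (continuous_gradient_fst hφ))).add
      (hH₂.comp (continuous_gradient_snd hφ))
  have hφc : Continuous φ := hφ.continuous
  obtain ⟨r, hr, hrU, hrV, hrmax⟩ : ∃ r > 0, closedBall x₀ r ⊆ U ∧ closedBall y₀ r ⊆ V ∧
      ∀ z ∈ closedBall x₀ r ×ˢ closedBall y₀ r, z ≠ (x₀, y₀) →
        w z.1 + v z.2 - φ z < w x₀ + v y₀ - φ (x₀, y₀) := by
    obtain ⟨r₁, hr₁, h₁⟩ := Metric.nhds_basis_closedBall.mem_iff.1 hU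
    obtain ⟨r₂, hr₂, h₂⟩ := Metric.nhds_basis_closedBall.mem_iff.1 hV
    obtain ⟨r₃, hr₃, h₃⟩ := Metric.nhds_basis_closedBall.mem_iff.1 hmax
    refine ⟨min r₁ (min r₂ r₃), by positivity,
      (closedBall_subset_closedBall (min_le_left _ _)).trans h₁,
      (closedBall_subset_closedBall ((min_le_right _ _).trans (min_le_left _ _))).trans h₂, ?_⟩
    intro z hz
    rw [closedBall_prod_same] at hz
    exact h₃ (closedBall_subset_closedBall ((min_le_right _ _).trans (min_le_right _ _)) hz)
  set B : Set (Euc N × Euc N) := closedBall x₀ r ×ˢ closedBall y₀ r with hBdef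
  have hB : IsCompact B := (isCompact_closedBall _ _).prod (isCompact_closedBall _ _)
  let G : (Euc N × Euc N) × (Euc N × Euc N) → ℝ := fun p => w p.1.1 + v p.1.2 - φ p.2
  let q : (Euc N × Euc N) × (Euc N × Euc N) → ℝ :=
    fun p => ‖p.2.1 - p.1.1‖ ^ 2 + ‖p.2.2 - p.1.2‖ ^ 2
  have hG : Continuous G := by fun_prop
  have hq : Continuous q := by fun_prop
  let O : Set ((Euc N × Euc N) × (Euc N × Euc N)) :=
    ((ball x₀ r ×ˢ ball y₀ r) ×ˢ (ball x₀ r ×ˢ ball y₀ r)) ∩ {p | K₁ + K₂ < L p.2}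
  have hO : IsOpen O := ((isOpen_ball.prod isOpen_ball).prod (isOpen_ball.prod isOpen_ball)).inter
    (isOpen_lt continuous_const (hLc.comp continuous_snd))
  have hPO : ((x₀, y₀), (x₀, y₀)) ∈ O := by
    refine ⟨⟨⟨?_, ?_⟩, ?_, ?_⟩, hlt⟩ <;> simp [hr]
  have hev := eventually_penalized_lt hB hG hq (fun p => by positivity) (fun p hp => by
      have h : p.2.1 - p.1.1 ≠ 0 ∨ p.2.2 - p.1.2 ≠ 0 := by
        by_contra! h
        exact hp (Prod.ext (sub_eq_zero.1 h.1).symm (sub_eq_zero.1 h.2).symm)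
      rcases h with h | h <;> [have := norm_pos_iff.2 h; have := norm_pos_iff.2 h] <;> positivity)
    hrmax hO hPO
  obtain ⟨k, hk, hk₀⟩ := (hev.and (eventually_gt_atTop 0)).exists
  obtain ⟨⟨⟨x', y'⟩, ⟨x, y⟩⟩, hpB, hpmax⟩ := (hB.prod hB).exists_isMaxOn
    ⟨((x₀, y₀), (x₀, y₀)), by simp [hBdef, hr.le]⟩ (hG.sub (hq.const_mul k)).continuousOn
  have hmaxO : ∀ p ∈ B ×ˢ B, G ((x', y'), (x, y)) - k * q ((x', y'), (x, y)) ≤ G p - k * q p →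
      p ∈ O := by
    intro p hp hle
    by_contra hpO
    have h1 := hk p ⟨hp, hpO⟩
    have h2 := hpmax (show ((x₀, y₀), (x₀, y₀)) ∈ B ×ˢ B by simp [hBdef, hr.le])
    simp only [mem_ofPred_eq, G, q] at h2 hle h1
    norm_num at h2
    linarith
  have hpO := hmaxO _ hpB le_rfl
  obtain ⟨⟨⟨hx'b, hy'b⟩, hxb, hyb⟩, hLgt⟩ := hpO
  simp only at hx'b hy'b hxb hyb hLgt
  have hineq (a b c d : Euc N) (ha : a ∈ closedBall x₀ r) (hb : b ∈ closedBall y₀ r)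
      (hc : c ∈ closedBall x₀ r) (hd : d ∈ closedBall y₀ r) :
      w a + v b - φ (c, d) - k * (‖c - a‖ ^ 2 + ‖d - b‖ ^ 2) ≤
        w x' + v y' - φ (x, y) - k * (‖x - x'‖ ^ 2 + ‖y - y'‖ ^ 2) :=
    hpmax (show ((a, b), (c, d)) ∈ B ×ˢ B from ⟨⟨ha, hb⟩, hc, hd⟩)
  have hx's := ball_subset_closedBall hx'b
  have hy's := ball_subset_closedBall hy'b
  have hxs := ball_subset_closedBall hxb
  have hys := ball_subset_closedBall hyb
  have hdx : Differentiable ℝ (fun x => φ (x, y)) :=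
    (hφ.comp (contDiff_prodMk_left y)).differentiable (by norm_num)
  have hdy : Differentiable ℝ (fun y => φ (x, y)) :=
    (hφ.comp (contDiff_prodMk_right x)).differentiable (by norm_num)
  have hdq (c z : Euc N) : DifferentiableAt ℝ (fun y => -(k * ‖y - c‖ ^ 2)) z :=
    ((contDiff_const.mul (contDiff_norm_sub_sq c)).neg.differentiable (by norm_num)) z
  have hgx (a : Euc N) (ha : a ∈ closedBall x₀ r)
      (hle : w x' - k * ‖x - x'‖ ^ 2 ≤ w a - k * ‖x - a‖ ^ 2) :
      gradient (fun x => φ (x, y)) x = (2 * k) • (a - x) := by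
    rw [← gradient_neg_const_mul_norm_sub_sq]
    refine (gradient_eq_of_isLocalMax_sub (hdq a x) (hdx x) ?_).symm
    filter_upwards [isOpen_ball.mem_nhds hxb] with z hz
    have := hineq a y' z y ha hy's (ball_subset_closedBall hz) hys
    linarith
  have hgy (b : Euc N) (hb : b ∈ closedBall y₀ r)
      (hle : v y' - k * ‖y - y'‖ ^ 2 ≤ v b - k * ‖y - b‖ ^ 2) :
      gradient (fun y => φ (x, y)) y = (2 * k) • (b - y) := by
    rw [← gradient_neg_const_mul_norm_sub_sq]
    refine (gradient_eq_of_isLocalMax_sub (hdq b y) (hdy y) ?_).symm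
    filter_upwards [isOpen_ball.mem_nhds hyb] with z hz
    have := hineq x' b x z hx's hb hxs (ball_subset_closedBall hz)
    linarith
  have hk2 : 2 * k ≠ 0 := by positivity
  set S := K₁ + K₂
  set δ := (L (x, y) - S) / 4 with hδ
  have hS : S < L (x, y) := hLgt
  have hδ₀ : 0 < δ := by rw [hδ]; linarith
  have hgx' := hgx x' hx's le_rfl
  have hgy' := hgy y' hy's le_rfl
  obtain ⟨ρ₁, hρ₁, hW⟩ := (hws.mono (ball_subset_closedBall.trans hrU)).supConv (k := k) hH₁ hw
    (x₀ := x) hx'b (a := K₁ - H₁ ((2 * k) • (x' - x)) + δ) (fun a ha hne => by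
      by_contra! hle
      have h := (hgx a ha hle).symm.trans hgx'
      exact hne (sub_left_injective (smul_right_injective _ hk2 h))) (by linarith)
  obtain ⟨ρ₂, hρ₂, hY⟩ := (hvs.mono (ball_subset_closedBall.trans hrV)).supConv (k := k) hH₂ hv
    (x₀ := y) hy'b (a := K₂ - H₂ ((2 * k) • (y' - y)) + δ) (fun b hb hne => by
      by_contra! hle
      have h := (hgy b hb hle).symm.trans hgy'
      exact hne (sub_left_injective (smul_right_injective _ hk2 h))) (by linarith)
  have hWc : Continuous (supConv w x₀ r k) := continuous_supConv hw
  have hYc : Continuous (supConv v y₀ r k) := continuous_supConv hv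
  have hWx := le_supConv (k := k) hw x hx's
  have hYy := le_supConv (k := k) hv y hy's
  have hsum := neg_lapl_le_of_isLocalMax_add hN
    (W := fun ξ => supConv w x₀ r k (x + LinearIsometryEquiv.refl ℝ (Euc N) ξ))
    (Y := fun ξ => supConv v y₀ r k (y + R ξ)) (φ := fun ξ => φ (x + ξ, y + R ξ))
    (by fun_prop) (by fun_prop) (lt_min hρ₁ hρ₂)
    ((hW.comp_isometry _).mono (ball_subset_ball (min_le_left _ _)))
    ((hY.comp_isometry R).mono (ball_subset_ball (min_le_right _ _)))
    (hφ.comp ((contDiff_const.add contDiff_id).prodMk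
      (contDiff_const.add R.toContinuousLinearEquiv.contDiff))) ?_
  · rw [← hgx', ← hgy'] at hsum
    have : L (x, y) ≤ S + 2 * δ := by simp only [hL, S]; linarith
    linarith
  · have h1 : ∀ᶠ ξ in 𝓝 (0 : Euc N), x + ξ ∈ ball x₀ r :=
      ContinuousAt.eventually_mem (f := fun ξ => x + ξ) (by fun_prop)
        (isOpen_ball.mem_nhds (by simpa using hxb))
    have h2 : ∀ᶠ ξ in 𝓝 (0 : Euc N), y + R ξ ∈ ball y₀ r :=
      ContinuousAt.eventually_mem (f := fun ξ => y + R ξ) (by fun_prop)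
        (isOpen_ball.mem_nhds (by simpa using hyb))
    filter_upwards [h1, h2] with ξ hξ₁ hξ₂
    obtain ⟨a, ha, hWa⟩ := exists_supConv_eq (c := x₀) (k := k) hw hr.le (x + ξ)
    obtain ⟨b, hb, hYb⟩ := exists_supConv_eq (c := y₀) (k := k) hv hr.le (y + R ξ)
    have := hineq a b _ _ ha hb (ball_subset_closedBall hξ₁) (ball_subset_closedBall hξ₂)
    simp only [LinearIsometryEquiv.coe_refl, id, map_zero, add_zero]
    linarith

theorem gradient_add {N : ℕ} {φ ψ : Euc N → ℝ} {x : Euc N} (hφ : DifferentiableAt ℝ φ x)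
    (hψ : DifferentiableAt ℝ ψ x) :
    gradient (fun y => φ y + ψ y) x = gradient φ x + gradient ψ x := by
  rw [gradient, gradient, gradient, fderiv_fun_add hφ hψ, map_add]

/-- Doubling of variables for viscosity subsolutions, along the subspace `{(ξ, Rξ)}`. -/
theorem doubling {N : ℕ} (hN : 1 ≤ N) {w v : Euc N → ℝ} (hw : Continuous w)
    (hv : Continuous v) {U V : Set (Euc N)} {x₀ y₀ : Euc N} (hU : U ∈ 𝓝 x₀) (hV : V ∈ 𝓝 y₀)
    {H₁ H₂ : Euc N → ℝ} (hH₁ : Continuous H₁) (hH₂ : Continuous H₂) {K₁ K₂ : ℝ}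
    (hws : ViscSub U H₁ K₁ w) (hvs : ViscSub V H₂ K₂ v) {φ : Euc N × Euc N → ℝ}
    (hφ : ContDiffAt ℝ 2 φ (x₀, y₀))
    (hmax : IsLocalMax (fun z : Euc N × Euc N => w z.1 + v z.2 - φ z) (x₀, y₀))
    (R : Euc N ≃ₗᵢ[ℝ] Euc N) :
    -lapl (fun ξ => φ (x₀ + ξ, y₀ + R ξ)) 0 + H₁ (gradient (fun x => φ (x, y₀)) x₀)
      + H₂ (gradient (fun y => φ (x₀, y)) y₀) ≤ K₁ + K₂ := by
  obtain ⟨ψ, hψ, hψφ⟩ := exists_contDiff_eventuallyEq hφ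
  let Q : Euc N → Euc N → ℝ := fun c x => (‖x - c‖ ^ 2) ^ 2
  have hQ (c : Euc N) : ContDiff ℝ 2 (Q c) := (contDiff_norm_sub_sq c).pow 2
  have hsq (t : ℝ) : HasDerivAt (fun t : ℝ => t ^ 2) (2 * t) t := by simpa using hasDerivAt_pow 2 t
  have hsq' (t : ℝ) : HasDerivAt (fun t : ℝ => 2 * t) 2 t := by
    simpa using (hasDerivAt_id t).const_mul 2
  have hQg (c : Euc N) : gradient (Q c) c = 0 := by
    have := gradient_radial (F := fun t => t ^ 2) c (x := c) (hsq _)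
    simpa using this
  have hQl (c : Euc N) : lapl (Q c) c = 0 := by
    have := lapl_radial (F := fun t => t ^ 2) (F' := fun t => 2 * t) (F'' := 2) c (x := c)
      (.of_forall hsq) (hsq' _)
    simpa using this
  have hχ : ContDiff ℝ 2 (fun z : Euc N × Euc N => ψ z + (Q x₀ z.1 + Q y₀ z.2)) :=
    hψ.add (((hQ x₀).fst').add ((hQ y₀).snd'))
  have hA : ContDiff ℝ 2 (fun ξ : Euc N => (x₀ + ξ, y₀ + R ξ)) :=
    (contDiff_const.add contDiff_id).prodMk
      (contDiff_const.add R.toContinuousLinearEquiv.contDiff)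
  have hA₁ : ContDiff ℝ 2 (fun ξ : Euc N => x₀ + ξ) := contDiff_const.add contDiff_id
  have hA₂ : ContDiff ℝ 2 (fun ξ : Euc N => y₀ + R ξ) :=
    contDiff_const.add R.toContinuousLinearEquiv.contDiff
  have hmain := doubling_of_strict hN hw hv hU hV hH₁ hH₂ hws hvs hχ ?_ R
  · have e1 : lapl (fun ξ => Q x₀ (x₀ + ξ)) 0 = 0 := by
      have := lapl_comp_similarity (hQ x₀) x₀ 1 (LinearIsometryEquiv.refl ℝ _) 0
      simpa [hQl] using this
    have e2 : lapl (fun ξ => Q y₀ (y₀ + R ξ)) 0 = 0 := by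
      have := lapl_comp_similarity (hQ y₀) y₀ 1 R 0
      simpa [hQl] using this
    have c₀ : ContDiff ℝ 2 (fun ξ => ψ (x₀ + ξ, y₀ + R ξ)) := hψ.comp hA
    have c₁ : ContDiff ℝ 2 (fun ξ => Q x₀ (x₀ + ξ)) := (hQ x₀).comp hA₁
    have c₂ : ContDiff ℝ 2 (fun ξ => Q y₀ (y₀ + R ξ)) := (hQ y₀).comp hA₂
    have d₁ : Differentiable ℝ (fun x => ψ (x, y₀)) :=
      (hψ.comp (contDiff_prodMk_left y₀)).differentiable (by norm_num)
    have d₂ : Differentiable ℝ (fun y => ψ (x₀, y)) :=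
      (hψ.comp (contDiff_prodMk_right x₀)).differentiable (by norm_num)
    have d₃ (c : Euc N) : Differentiable ℝ (Q c) := (hQ c).differentiable (by norm_num)
    simp only at hmain
    rw [lapl_add c₀.contDiffAt (c₁.add c₂).contDiffAt, lapl_add c₁.contDiffAt c₂.contDiffAt, e1, e2,
      gradient_add (d₁ x₀) ((d₃ x₀ x₀).add_const _), gradient_add (d₂ y₀) ((d₃ y₀ y₀).const_add _),
      gradient_add (d₃ x₀ x₀) (differentiableAt_const _),
      gradient_add (differentiableAt_const _) (d₃ y₀ y₀),
      gradient_fun_const, gradient_fun_const, hQg, hQg] at hmain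
    simp only [add_zero] at hmain
    have t1 : Tendsto (fun ξ : Euc N => (x₀ + ξ, y₀ + R ξ)) (𝓝 0) (𝓝 (x₀, y₀)) := by
      simpa using hA.continuous.tendsto 0
    have t2 : Tendsto (fun x : Euc N => (x, y₀)) (𝓝 x₀) (𝓝 (x₀, y₀)) :=
      Continuous.tendsto (by fun_prop) _
    have t3 : Tendsto (fun y : Euc N => (x₀, y)) (𝓝 y₀) (𝓝 (x₀, y₀)) :=
      Continuous.tendsto (by fun_prop) _
    rwa [lapl_congr (t1.eventually hψφ), gradient_congr (t2.eventually hψφ),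
      gradient_congr (t3.eventually hψφ)] at hmain
  · filter_upwards [hmax, hψφ] with z hz hzφ hne
    have h0 : ψ (x₀, y₀) = φ (x₀, y₀) := hψφ.self_of_nhds
    have hpos : 0 < Q x₀ z.1 + Q y₀ z.2 := by
      have h : z.1 - x₀ ≠ 0 ∨ z.2 - y₀ ≠ 0 := by
        by_contra! h
        exact hne (Prod.ext (sub_eq_zero.1 h.1) (sub_eq_zero.1 h.2))
      simp only [Q]
      rcases h with h | h <;> [have := norm_pos_iff.2 h; have := norm_pos_iff.2 h] <;> positivity
    have h1 : Q x₀ x₀ = 0 := by simp [Q]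
    have h2 : Q y₀ y₀ = 0 := by simp [Q]
    rw [h0, hzφ, h1, h2]
    linarith

theorem ViscSub.of_contDiffAt {N : ℕ} {U : Set (Euc N)} {H : Euc N → ℝ} {K : ℝ} {w : Euc N → ℝ}
    (h : ViscSub U H K w) {φ : Euc N → ℝ} {x : Euc N} (hφ : ContDiffAt ℝ 2 φ x) (hx : x ∈ U)
    (hmax : IsLocalMax (fun y => w y - φ y) x) : -lapl φ x + H (gradient φ x) ≤ K := by
  obtain ⟨ψ, hψ, hψφ⟩ := exists_contDiff_eventuallyEq hφ
  rw [← lapl_congr hψφ, ← gradient_congr hψφ]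
  refine h ψ hψ x hx ?_
  filter_upwards [hmax, hψφ] with y hy hyφ
  rw [hyφ, hψφ.self_of_nhds]
  exact hy

set_option maxHeartbeats 1000000 in
/-- The function `t ↦ B (t ^ (α / 2) + 1 / (1 - t) - 1)`, composed with `|x - y|²`, is a strict
supersolution of `-Δw + |Dw|^m = C` in the punctured unit ball. -/
theorem barrier_ineq {m : ℝ} (hm : 2 < m) (N : ℕ) {C : ℝ} (hC : 0 ≤ C) :
    ∃ B : ℝ, 1 ≤ B ∧ ∀ s : ℝ, 0 < s → s < 1 → ∀ α : ℝ, α = (m - 2) / (m - 1) →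
      C < -(4 * (B * (α / 2 * ((α / 2 - 1) * (s ^ 2) ^ (α / 2 - 1 - 1)) + 2 / (1 - s ^ 2) ^ 3)) *
          s ^ 2 + 2 * N * (B * (α / 2 * (s ^ 2) ^ (α / 2 - 1) + 1 / (1 - s ^ 2) ^ 2))) +
        (2 * (B * (α / 2 * (s ^ 2) ^ (α / 2 - 1) + 1 / (1 - s ^ 2) ^ 2)) * s) ^ m := by
  set α := (m - 2) / (m - 1) with hαdef
  have hm1 : 0 < m - 1 := by linarith
  have hα : 0 < α := div_pos (by linarith) hm1
  have hα1 : α < 1 := by rw [hαdef, div_lt_one hm1]; linarith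
  have hαm : (α - 1) * (m - 1) = -1 := by rw [hαdef]; field_simp; ring
  set D := C * (1 / α ^ m) + 2 * (α ^ 2 / α ^ m) + N * (α / α ^ m) with hD
  have hD0 : 0 ≤ D := by positivity
  have ring_aux (B a Z X s : ℝ) : 4 * (B * (a * ((a - 1) * Z) + X)) * s ^ 2 =
      B * (X * s ^ 2 * 4) - 4 * (B * (a * ((1 - a) * Z)) * s ^ 2) := by ring
  obtain ⟨B, hBD⟩ : ∃ B, B = D + 1 := ⟨_, rfl⟩
  have hB : 1 ≤ B := by linarith
  refine ⟨B, hB, ?_⟩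
  intro s hs hs1 α' hα'
  rw [hα']
  have ht1 : 0 < 1 - s ^ 2 := by nlinarith
  set T := (s ^ 2) ^ (α / 2 - 1) with hT
  have hT0 : 0 < T := by positivity
  set E := 1 / (1 - s ^ 2) ^ 2 with hE
  have hE1 : 1 ≤ E := by
    rw [hE, le_div_iff₀ (by positivity)]
    nlinarith [sq_nonneg s]
  set P := 2 * (α / 2 * T + E) * s with hP
  have hTs : T * s = s ^ (α - 1) := by
    rw [hT, ← Real.rpow_natCast, ← Real.rpow_mul hs.le, show α - 1 = (2 : ℕ) * (α / 2 - 1) + 1 by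
      push_cast; ring, Real.rpow_add hs, Real.rpow_one]
  have hTs1 : 1 ≤ s ^ (α - 1) := by
    have := Real.one_le_rpow_of_pos_of_le_one_of_nonpos hs hs1.le (show α - 1 ≤ 0 by linarith)
    exact this
  have hPe : P = α * s ^ (α - 1) + 2 * E * s := by rw [hP, ← hTs]; ring
  have hPα : α * s ^ (α - 1) ≤ P := by
    rw [hPe]
    have : 0 ≤ 2 * E * s := by positivity
    linarith
  have hPα1 : α ≤ P := (le_mul_of_one_le_right hα.le hTs1).trans hPα
  have hP0 : 0 < P := by linarith
  have hαm0 : 0 < α ^ m := by positivity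
  set Y := P ^ m with hY
  have hY0 : 0 < Y := by positivity
  have hQ1 : 1 ≤ P / α := by rwa [one_le_div hα]
  have hYα : (P / α) ^ m = Y / α ^ m := Real.div_rpow hP0.le hα.le m
  have i1 : 1 ≤ Y / α ^ m := by rw [← hYα]; exact Real.one_le_rpow hQ1 (by linarith)
  have i2 : (P / α) ^ 2 ≤ Y / α ^ m := by
    rw [← hYα, ← Real.rpow_natCast]
    exact Real.rpow_le_rpow_of_exponent_le hQ1 (by push_cast; linarith)
  have i3 : P / s ≤ α * (Y / α ^ m) := by
    have h1 : 1 / s ≤ (P / α) ^ (m - 1) := by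
      have h2 : s ^ (α - 1) ≤ P / α := by rw [le_div_iff₀ hα]; linarith
      have h3 := Real.rpow_le_rpow (by positivity) h2 hm1.le
      rwa [← Real.rpow_mul hs.le, hαm, Real.rpow_neg_one, inv_eq_one_div] at h3
    rw [← hYα, show m = (m - 1) + 1 by ring, Real.rpow_add (by positivity), Real.rpow_one]
    have h4 : α * ((P / α) ^ (m - 1) * (P / α)) = P * (P / α) ^ (m - 1) := by field_simp
    rw [h4, div_eq_mul_one_div]
    gcongr
  have i4 : 2 / (1 - s ^ 2) ^ 3 * s ^ 2 * 4 ≤ 2 * P ^ 2 := by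
    have h1 : 2 * E * s ≤ P := by
      rw [hPe]
      have : 0 ≤ α * s ^ (α - 1) := by positivity
      linarith
    have h2 : (2 * E * s) ^ 2 ≤ P ^ 2 := by gcongr
    have h3 : 1 / (1 - s ^ 2) ^ 3 ≤ E ^ 2 := by
      rw [hE, div_pow, one_pow, ← pow_mul]
      apply one_div_le_one_div_of_le (by positivity)
      exact pow_le_pow_of_le_one ht1.le (by nlinarith) (by norm_num)
    have h4 := mul_le_mul_of_nonneg_right h3 (sq_nonneg s)
    calc 2 / (1 - s ^ 2) ^ 3 * s ^ 2 * 4 = 8 * (1 / (1 - s ^ 2) ^ 3 * s ^ 2) := by ring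
      _ ≤ 8 * (E ^ 2 * s ^ 2) := by linarith
      _ = 2 * (2 * E * s) ^ 2 := by ring
      _ ≤ 2 * P ^ 2 := by linarith
  have hDY : C + 2 * P ^ 2 + N * (P / s) ≤ D * Y := by
    have h1 : C ≤ C * (Y / α ^ m) := le_mul_of_one_le_right hC i1
    have h2 : P ^ 2 ≤ α ^ 2 * (Y / α ^ m) := by
      rw [div_pow, div_le_iff₀ (by positivity)] at i2
      linarith
    have h3 : N * (P / s) ≤ N * (α * (Y / α ^ m)) := by gcongr
    have h4 : D * Y = C * (Y / α ^ m) + 2 * (α ^ 2 * (Y / α ^ m)) + N * (α * (Y / α ^ m)) := by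
      rw [hD]; ring
    linarith
  have hBm : B * B ≤ B ^ m := by
    have := Real.rpow_le_rpow_of_exponent_le hB (show ((2 : ℕ) : ℝ) ≤ m by push_cast; linarith)
    rwa [Real.rpow_natCast, pow_two] at this
  have e1 : (2 * (B * (α / 2 * T + E)) * s) ^ m = B ^ m * Y := by
    rw [show 2 * (B * (α / 2 * T + E)) * s = B * P by rw [hP]; ring,
      Real.mul_rpow (by linarith) hP0.le]
  have e2 : 2 * N * (B * (α / 2 * T + E)) = B * (N * (P / s)) := by
    rw [hP]; field_simp
  have hZ : 0 ≤ B * (α / 2 * ((1 - α / 2) * (s ^ 2) ^ (α / 2 - 1 - 1))) * s ^ 2 := by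
    have : 0 ≤ 1 - α / 2 := by linarith
    positivity
  have e3 : 4 * (B * (α / 2 * ((α / 2 - 1) * (s ^ 2) ^ (α / 2 - 1 - 1)) + 2 / (1 - s ^ 2) ^ 3)) *
      s ^ 2 ≤ B * (2 * P ^ 2) := by
    have h := mul_le_mul_of_nonneg_left i4 (show 0 ≤ B by linarith)
    rw [ring_aux]
    linarith
  rw [e1, e2]
  have f1 := mul_le_mul_of_nonneg_right hBm hY0.le
  have f2 := mul_le_mul_of_nonneg_left hDY (show 0 ≤ B by linarith)
  have f3 : C ≤ B * C := le_mul_of_one_le_left hC hB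
  have f4 : 0 < B * Y := by positivity
  have f5 : B * B * Y = B * (D * Y) + B * Y := by
    rw [mul_assoc, ← mul_add]; congr 1; rw [hBD]; ring
  have f6 : B * (C + 2 * P ^ 2 + N * (P / s)) = B * C + B * (2 * P ^ 2) + B * (N * (P / s)) := by
    ring
  linarith

/-- Interior Hölder bound for viscosity subsolutions of `-Δv + |Dv|^m ≤ C` with `m > 2`. -/
theorem exists_holder_bound (N : ℕ) {m : ℝ} (hm : 2 < m) {C : ℝ} (hC : 0 ≤ C) :
    ∃ C₀ : ℝ, 0 < C₀ ∧ ∀ v : Euc N → ℝ, Continuous v → ∀ y : Euc N,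
      ViscSub (ball y 1) (fun p => ‖p‖ ^ m) C v →
        ∀ x, ‖x - y‖ ≤ 1 / 2 → v x - v y ≤ C₀ * ‖x - y‖ ^ ((m - 2) / (m - 1)) := by
  obtain ⟨B, hB, hbar⟩ := barrier_ineq hm N hC
  set α := (m - 2) / (m - 1) with hα
  have hm1 : 0 < m - 1 := by linarith
  have hα0 : 0 < α := div_pos (by linarith) hm1
  have hα1 : α < 1 := by rw [hα, div_lt_one hm1]; linarith
  refine ⟨3 * B, by positivity, fun v hv y hs x hx => ?_⟩
  let F : ℝ → ℝ := fun t => B * (t ^ (α / 2) + (1 - t)⁻¹ - 1)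
  let F' : ℝ → ℝ := fun t => B * (α / 2 * t ^ (α / 2 - 1) + 1 / (1 - t) ^ 2)
  let F'' : ℝ → ℝ := fun t => B * (α / 2 * ((α / 2 - 1) * t ^ (α / 2 - 1 - 1)) + 2 / (1 - t) ^ 3)
  have hsub (t : ℝ) : HasDerivAt (fun t : ℝ => 1 - t) (-1) t := by
    simpa using (hasDerivAt_id t).const_sub 1
  have hF (t : ℝ) (h0 : t ≠ 0) (h1 : 1 - t ≠ 0) : HasDerivAt F (F' t) t := by
    have := (((Real.hasDerivAt_rpow_const (p := α / 2) (Or.inl h0)).add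
      ((hsub t).inv h1)).sub_const 1).const_mul B
    refine this.congr_deriv ?_
    simp only [F', neg_neg]
  have hF' (t : ℝ) (h0 : t ≠ 0) (h1 : 1 - t ≠ 0) : HasDerivAt F' (F'' t) t := by
    have hsq : HasDerivAt (fun t : ℝ => (1 - t) ^ 2) (-(2 * (1 - t))) t :=
      ((hsub t).pow 2).congr_deriv (by push_cast; ring)
    have := (((Real.hasDerivAt_rpow_const (p := α / 2 - 1) (Or.inl h0)).const_mul (α / 2)).add
      (hsq.inv (pow_ne_zero 2 h1))).const_mul B
    refine (this.congr_deriv ?_).congr_of_eventuallyEq (.of_forall fun t => ?_)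
    · simp only [F'']
      congr 2
      field_simp
    · simp [F']
  obtain ⟨M, hM⟩ : ∃ M, ∀ z ∈ closedBall y 1, v z ≤ M := by
    obtain ⟨M, hM⟩ := (isCompact_closedBall y 1).bddAbove_image hv.continuousOn
    exact ⟨M, fun z hz => hM (mem_image_of_mem v hz)⟩
  obtain ⟨ρ, hρ, hρ1, hρF⟩ : ∃ ρ : ℝ, 1 / 2 < ρ ∧ ρ < 1 ∧ M - v y < F (ρ ^ 2) := by
    have h1 : Tendsto (fun ρ : ℝ => 1 - ρ ^ 2) (𝓝[<] 1) (𝓝[>] 0) := by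
      refine tendsto_nhdsWithin_iff.2 ⟨?_, ?_⟩
      · have : Tendsto (fun ρ : ℝ => 1 - ρ ^ 2) (𝓝 1) (𝓝 (1 - 1 ^ 2)) :=
          Continuous.tendsto (by fun_prop) 1
        simpa using this.mono_left nhdsWithin_le_nhds
      · filter_upwards [Ioo_mem_nhdsLT (show (0 : ℝ) < 1 by norm_num)] with ρ hρ
        simp only [mem_Ioi]
        nlinarith [hρ.1, hρ.2]
    have h2 := tendsto_inv_nhdsGT_zero.comp h1
    have hI : ∀ᶠ ρ : ℝ in 𝓝[<] 1, ρ ∈ Ioo (1 / 2 : ℝ) 1 := Ioo_mem_nhdsLT (by norm_num)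
    obtain ⟨ρ, hρ⟩ := (hI.and (h2.eventually_gt_atTop (|M - v y| + 1))).exists
    refine ⟨ρ, hρ.1.1, hρ.1.2, ?_⟩
    have h3 : |M - v y| + 1 < (1 - ρ ^ 2)⁻¹ := hρ.2
    have h4 : 0 ≤ (ρ ^ 2) ^ (α / 2) := by positivity
    have h5 := le_abs_self (M - v y)
    simp only [F]
    nlinarith [abs_nonneg (M - v y)]
  have hFc : ContinuousOn (fun z : Euc N => F (‖z - y‖ ^ 2)) (closedBall y ρ) := by
    intro z hz
    have hz' : ‖z - y‖ ≤ ρ := mem_closedBall_iff_norm.1 hz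
    have h1 : 1 - ‖z - y‖ ^ 2 ≠ 0 := by nlinarith [norm_nonneg (z - y)]
    refine ContinuousAt.continuousWithinAt ?_
    refine continuousAt_const.mul ((ContinuousAt.add ?_ ?_).sub continuousAt_const)
    · exact ContinuousAt.rpow_const (by fun_prop) (Or.inr (by positivity))
    · exact ContinuousAt.inv₀ (by fun_prop) h1
  obtain ⟨z, hz, hzmax⟩ := (isCompact_closedBall y ρ).exists_isMaxOn
    ⟨y, by simp; linarith⟩ (hv.continuousOn.sub hFc)
  have hF0 : F (‖y - y‖ ^ 2) = 0 := by
    simp [F, Real.zero_rpow (show α / 2 ≠ 0 by positivity)]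
  have hzy : z = y := by
    by_contra hne
    have hpos : 0 < ‖z - y‖ := norm_pos_iff.2 (sub_ne_zero.2 hne)
    rcases (mem_closedBall_iff_norm.1 hz).lt_or_eq with hlt | heq
    · have h0 : ‖z - y‖ ^ 2 ≠ 0 := by positivity
      have h1 : 1 - ‖z - y‖ ^ 2 ≠ 0 := by nlinarith
      have hlap := lapl_radial (F := F) (F' := F') (F'' := F'' (‖z - y‖ ^ 2)) y (x := z) (by
        have : ∀ᶠ t : ℝ in 𝓝 (‖z - y‖ ^ 2), t ≠ 0 ∧ 1 - t ≠ 0 :=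
          (continuousAt_id.eventually_ne h0).and
            (ContinuousAt.eventually_ne (g := fun t : ℝ => 1 - t) (by fun_prop) h1)
        exact this.mono fun t ht => hF t ht.1 ht.2) (hF' _ h0 h1)
      have hgrad := gradient_radial y (hF _ h0 h1)
      have hcd : ContDiffAt ℝ 2 (fun x : Euc N => F (‖x - y‖ ^ 2)) z := by
        have hsq := (contDiff_norm_sub_sq y).contDiffAt (x := z)
        exact contDiffAt_const.mul (((hsq.rpow_const_of_ne h0).add
          ((contDiffAt_const.sub hsq).inv h1)).sub contDiffAt_const)
      have key := hs.of_contDiffAt hcd (mem_ball_iff_norm.2 (by linarith)) (by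
        filter_upwards [isOpen_ball.mem_nhds (mem_ball_iff_norm.2 hlt)] with x hx
        exact hzmax (ball_subset_closedBall hx))
      rw [hlap, hgrad, norm_smul, Real.norm_of_nonneg (by
        have : 0 ≤ 1 - ‖z - y‖ ^ 2 := by nlinarith
        simp only [F']
        positivity)] at key
      exact absurd key (not_le.2 (hbar ‖z - y‖ hpos (by linarith) α rfl))
    · have h1 : v y - F (‖y - y‖ ^ 2) ≤ v z - F (‖z - y‖ ^ 2) := hzmax (by simp; linarith)
      have h2 := hM z (mem_closedBall_iff_norm.2 (by linarith))
      rw [heq, hF0] at h1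
      linarith
  have h1 : v x - F (‖x - y‖ ^ 2) ≤ v z - F (‖z - y‖ ^ 2) :=
    hzmax (mem_closedBall_iff_norm.2 (by linarith))
  rw [hzy, hF0] at h1
  have hs0 := norm_nonneg (x - y)
  set s := ‖x - y‖
  have h2 : (s ^ 2) ^ (α / 2) = s ^ α := by
    rw [← Real.rpow_natCast, ← Real.rpow_mul hs0]; congr 1; push_cast; ring
  have h3 : (1 - s ^ 2)⁻¹ - 1 ≤ 2 * s := by
    have : (1 - s ^ 2)⁻¹ ≤ 1 + 2 * s := by
      rw [inv_le_iff_one_le_mul₀ (by nlinarith)]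
      nlinarith
    linarith
  have h4 : s ≤ s ^ α := by
    rcases hs0.eq_or_lt with h | h
    · rw [← h, Real.zero_rpow hα0.ne']
    · simpa using Real.rpow_le_rpow_of_exponent_ge h (by linarith) hα1.le
  have h5 : F (s ^ 2) ≤ 3 * B * s ^ α := by
    simp only [F, h2]
    nlinarith
  linarith

theorem gradient_comp_norm_sub {N : ℕ} {k : ℝ → ℝ} {k' : ℝ} {c x : Euc N} (hx : x ≠ c)
    (hk : HasDerivAt k k' ‖x - c‖) :
    gradient (fun y => k ‖y - c‖) x = (k' / ‖x - c‖) • (x - c) := by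
  have h0 : ‖x - c‖ ≠ 0 := norm_ne_zero_iff.2 (sub_ne_zero.2 hx)
  have hF : HasDerivAt (fun t => k √t) (k' * (1 / (2 * √(‖x - c‖ ^ 2)))) (‖x - c‖ ^ 2) := by
    refine HasDerivAt.comp _ ?_ (Real.hasDerivAt_sqrt (pow_ne_zero 2 h0))
    rwa [Real.sqrt_sq (norm_nonneg _)]
  have := gradient_radial c hF
  simp only [Real.sqrt_sq (norm_nonneg _)] at this
  rw [this]
  congr 1
  field_simp

/-- The doubling inequality for a radial penalisation, evaluated along the reflection exchanging
the two points. -/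
theorem doubling_radial {N : ℕ} (hN : 1 ≤ N) {w v : Euc N → ℝ} (hw : Continuous w)
    (hv : Continuous v) {U V : Set (Euc N)} {x₀ y₀ : Euc N} (hU : U ∈ 𝓝 x₀) (hV : V ∈ 𝓝 y₀)
    {H₁ H₂ : Euc N → ℝ} (hH₁ : Continuous H₁) (hH₂ : Continuous H₂) {K₁ K₂ : ℝ}
    (hws : ViscSub U H₁ K₁ w) (hvs : ViscSub V H₂ K₂ v) (hne : x₀ ≠ y₀) {k k' : ℝ → ℝ} {k'' A : ℝ}
    (hk : ContDiffAt ℝ 2 k ‖x₀ - y₀‖) (hk' : ∀ᶠ t in 𝓝 ‖x₀ - y₀‖, HasDerivAt k (k' t) t)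
    (hk'' : HasDerivAt k' k'' ‖x₀ - y₀‖)
    (hmax : IsLocalMax (fun z : Euc N × Euc N =>
      w z.1 + v z.2 - (k ‖z.1 - z.2‖ + (A * ‖z.1‖ ^ 2 + A * ‖z.2‖ ^ 2))) (x₀, y₀)) :
    -(4 * k'' + 4 * N * A)
      + H₁ ((k' ‖x₀ - y₀‖ / ‖x₀ - y₀‖) • (x₀ - y₀) + (2 * A) • x₀)
      + H₂ (-((k' ‖x₀ - y₀‖ / ‖x₀ - y₀‖) • (x₀ - y₀)) + (2 * A) • y₀) ≤ K₁ + K₂ := by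
  set z := x₀ - y₀ with hz
  have hz0 : z ≠ 0 := sub_ne_zero.2 hne
  have hs : 0 < ‖z‖ := norm_pos_iff.2 hz0
  set R : Euc N ≃ₗᵢ[ℝ] Euc N := (ℝ ∙ z)ᗮ.reflection with hR
  have hφ : ContDiffAt ℝ 2 (fun z : Euc N × Euc N =>
      k ‖z.1 - z.2‖ + (A * ‖z.1‖ ^ 2 + A * ‖z.2‖ ^ 2)) (x₀, y₀) := by
    refine ContDiffAt.add ?_ (ContDiffAt.add ?_ ?_)
    · exact ContDiffAt.comp (x₀, y₀) hk
        ((contDiffAt_norm ℝ hz0).comp (x₀, y₀) (contDiffAt_fst.sub contDiffAt_snd))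
    · exact contDiffAt_const.mul (contDiffAt_fst.norm_sq ℝ)
    · exact contDiffAt_const.mul (contDiffAt_snd.norm_sq ℝ)
  have key := doubling hN hw hv hU hV hH₁ hH₂ hws hvs hφ hmax R
  have hdiff {c y : Euc N} : DifferentiableAt ℝ (fun x : Euc N => A * ‖x‖ ^ 2 + A * ‖c‖ ^ 2) y := by
    simpa using ((((contDiff_norm_sub_sq 0).differentiable two_ne_zero).const_mul A).add_const
      (A * ‖c‖ ^ 2)) y
  have hdk (c y : Euc N) (hcy : y - c ≠ 0) (h : HasDerivAt k (k' ‖y - c‖) ‖y - c‖) :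
      DifferentiableAt ℝ (fun x : Euc N => k ‖x - c‖) y :=
    h.differentiableAt.comp y (((contDiffAt_norm ℝ hcy).differentiableAt one_ne_zero).comp y
      (by fun_prop))
  have hgA (c y : Euc N) : gradient (fun x : Euc N => A * ‖x‖ ^ 2 + A * ‖c‖ ^ 2) y
      = (2 * A) • y := by
    have := gradient_radial (F := fun t => A * t + A * ‖c‖ ^ 2) 0 (x := y)
      (by simpa using ((hasDerivAt_id _).const_mul A).add_const (A * ‖c‖ ^ 2))
    simpa using this
  have hkz := hk'.self_of_nhds
  have g₁ : gradient (fun x => k ‖x - y₀‖ + (A * ‖x‖ ^ 2 + A * ‖y₀‖ ^ 2)) x₀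
      = (k' ‖z‖ / ‖z‖) • z + (2 * A) • x₀ := by
    rw [gradient_add (hdk _ _ hz0 hkz) hdiff, hgA, gradient_comp_norm_sub hne hkz]
  have g₂ : gradient (fun y => k ‖x₀ - y‖ + (A * ‖x₀‖ ^ 2 + A * ‖y‖ ^ 2)) y₀
      = -((k' ‖z‖ / ‖z‖) • z) + (2 * A) • y₀ := by
    have hsw : ‖y₀ - x₀‖ = ‖z‖ := by rw [hz, norm_sub_rev]
    have hkz' : HasDerivAt k (k' ‖y₀ - x₀‖) ‖y₀ - x₀‖ := by rwa [hsw]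
    simp only [norm_sub_rev x₀, add_comm (A * ‖x₀‖ ^ 2)]
    rw [gradient_add (hdk _ _ (sub_ne_zero.2 hne.symm) hkz') hdiff, hgA,
      gradient_comp_norm_sub hne.symm hkz', hsw, hz, ← smul_neg, neg_sub]
  have hl : lapl (fun ξ => k ‖x₀ + ξ - (y₀ + R ξ)‖ + (A * ‖x₀ + ξ‖ ^ 2 + A * ‖y₀ + R ξ‖ ^ 2)) 0
      = 4 * k'' + 4 * N * A := by
    have hpos : ∀ᶠ ξ : Euc N in 𝓝 0, 0 < ‖z‖ + ⟪(2 / ‖z‖) • z, ξ⟫_ℝ := by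
      have : ContinuousAt (fun ξ : Euc N => ‖z‖ + ⟪(2 / ‖z‖) • z, ξ⟫_ℝ) 0 := by fun_prop
      exact this.eventually (lt_mem_nhds (by simpa using hs))
    have hcongr : (fun ξ => k ‖x₀ + ξ - (y₀ + R ξ)‖ + (A * ‖x₀ + ξ‖ ^ 2 + A * ‖y₀ + R ξ‖ ^ 2))
        =ᶠ[𝓝 0] fun ξ => k (‖z‖ + ⟪(2 / ‖z‖) • z, ξ⟫_ℝ)
          + (A * ‖ξ - -x₀‖ ^ 2 + A * ‖ξ - -R y₀‖ ^ 2) := by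
      filter_upwards [hpos] with ξ hξ
      have e₁ : x₀ + ξ - (y₀ + R ξ) = ((‖z‖ + ⟪(2 / ‖z‖) • z, ξ⟫_ℝ) / ‖z‖) • z := by
        rw [hR, Submodule.reflection_orthogonal_apply, Submodule.reflection_singleton_apply,
          real_inner_smul_left, add_div, div_self hs.ne', add_smul, one_smul, neg_sub, two_nsmul]
        simp only [RCLike.ofReal_real_eq_id, id_eq]
        rw [show x₀ + ξ - (y₀ + (ξ - ((⟪z, ξ⟫_ℝ / ‖z‖ ^ 2) • z + (⟪z, ξ⟫_ℝ / ‖z‖ ^ 2) • z)))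
          = z + ((⟪z, ξ⟫_ℝ / ‖z‖ ^ 2) • z + (⟪z, ξ⟫_ℝ / ‖z‖ ^ 2) • z) by rw [hz]; abel,
          ← add_smul]
        congr 2
        field_simp
        ring
      have e₂ : ‖y₀ + R ξ‖ = ‖ξ - -R y₀‖ := by
        rw [sub_neg_eq_add, ← R.norm_map (ξ + R y₀), map_add, hR, Submodule.reflection_reflection,
          add_comm]
      rw [e₁, norm_smul, Real.norm_of_nonneg (by positivity), div_mul_cancel₀ _ hs.ne', e₂,
        sub_neg_eq_add ξ x₀, add_comm ξ x₀]
    have hq (c : Euc N) : ContDiffAt ℝ 2 (fun ξ : Euc N => A * ‖ξ - c‖ ^ 2) 0 :=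
      contDiffAt_const.mul (contDiff_norm_sub_sq c).contDiffAt
    have h0 : ‖z‖ + ⟪(2 / ‖z‖) • z, (0 : Euc N)⟫_ℝ = ‖z‖ := by simp
    have hkc : ContDiffAt ℝ 2 (fun ξ : Euc N => k (‖z‖ + ⟪(2 / ‖z‖) • z, ξ⟫_ℝ)) 0 :=
      ContDiffAt.comp (0 : Euc N) (by rwa [h0])
        (contDiffAt_const.add (contDiffAt_const.inner ℝ contDiffAt_id))
    rw [lapl_congr hcongr, lapl_add hkc ((hq _).add (hq _)), lapl_add (hq _) (hq _),
      lapl_const_mul_norm_sub_sq, lapl_const_mul_norm_sub_sq,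
      lapl_ridge (k := k) (k' := k') (k'' := k'') _ (by rwa [h0]) (by rwa [h0]), norm_smul,
      Real.norm_of_nonneg (by positivity), div_mul_cancel₀ _ hs.ne']
    ring
  rw [← g₁, ← g₂, ← hl]
  exact key

/-- The tangent line inequality for the convex function `t ↦ t ^ m`. -/
theorem rpow_sub_rpow_le {a b m : ℝ} (ha : 0 ≤ a) (hb : 0 ≤ b) (hm : 1 < m) :
    b ^ m - a ^ m ≤ m * b ^ (m - 1) * (b - a) := by
  rcases hb.eq_or_lt with rfl | hb
  · rw [Real.zero_rpow (by linarith), Real.zero_rpow (by linarith)]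
    have := Real.rpow_nonneg ha m
    linarith
  · have h := one_add_mul_self_le_rpow_one_add (s := a / b - 1)
      (by linarith [div_nonneg ha hb.le]) hm.le
    rw [add_sub_cancel, Real.div_rpow ha hb.le, le_div_iff₀ (by positivity)] at h
    have e : b ^ m = b ^ (m - 1) * b := by
      rw [← Real.rpow_add_one hb.ne', sub_add_cancel]
    have : (1 + m * (a / b - 1)) * b ^ m = b ^ m - m * b ^ (m - 1) * (b - a) := by
      rw [e]; field_simp; ring
    linarith

/-- The doubling inequality for one viscosity solution of `-Δv + |Dv|^m + μ v = g`, `|g| ≤ K`. -/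
theorem doubling_solution {N : ℕ} (hN : 1 ≤ N) {m : ℝ} (hm : 0 ≤ m) {K μ : ℝ} (hμ : 0 ≤ μ)
    {v : Euc N → ℝ} (hv : Continuous v) {W : Set (Euc N)} (hW : IsOpen W)
    (hsub : ∀ φ : Euc N → ℝ, ContDiff ℝ 2 φ → ∀ x ∈ W,
      IsLocalMax (fun y => v y - φ y) x → -lapl φ x + ‖gradient φ x‖ ^ m + μ * v x ≤ K)
    (hsup : ∀ φ : Euc N → ℝ, ContDiff ℝ 2 φ → ∀ x ∈ W,
      IsLocalMin (fun y => v y - φ y) x → -K ≤ -lapl φ x + ‖gradient φ x‖ ^ m + μ * v x)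
    {p q : Euc N} (hp : p ∈ W) (hq : q ∈ W) (hne : p ≠ q) (hle : v q ≤ v p)
    {k k' : ℝ → ℝ} {k'' A : ℝ}
    (hk : ContDiffAt ℝ 2 k ‖p - q‖) (hk' : ∀ᶠ t in 𝓝 ‖p - q‖, HasDerivAt k (k' t) t)
    (hk'' : HasDerivAt k' k'' ‖p - q‖)
    (hmax : IsLocalMax (fun z : Euc N × Euc N =>
      v z.1 + -v z.2 - (k ‖z.1 - z.2‖ + (A * ‖z.1‖ ^ 2 + A * ‖z.2‖ ^ 2))) (p, q)) :
    -(4 * k'' + 4 * N * A) + ‖(k' ‖p - q‖ / ‖p - q‖) • (p - q) + (2 * A) • p‖ ^ m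
      - ‖-((k' ‖p - q‖ / ‖p - q‖) • (p - q)) + (2 * A) • q‖ ^ m ≤ 2 * K + 2 := by
  have hμc : Continuous fun x => μ * v x := by fun_prop
  have hU : {x | μ * v p - 1 < μ * v x} ∩ W ∈ 𝓝 p :=
    inter_mem (hμc.continuousAt.eventually (lt_mem_nhds (by linarith))) (hW.mem_nhds hp)
  have hV : {x | μ * v x < μ * v q + 1} ∩ W ∈ 𝓝 q :=
    inter_mem (hμc.continuousAt.eventually (gt_mem_nhds (by linarith))) (hW.mem_nhds hq)
  have hvU : ViscSub ({x | μ * v p - 1 < μ * v x} ∩ W) (fun a => ‖a‖ ^ m)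
      (K - μ * v p + 1) v := fun φ hφ x hx hm => by
    have h1 := hsub φ hφ x hx.2 hm
    have h2 : μ * v p - 1 < μ * v x := hx.1
    linarith
  have hvV : ViscSub ({x | μ * v x < μ * v q + 1} ∩ W) (fun a => -‖a‖ ^ m)
      (K + μ * v q + 1) (fun y => -v y) := fun φ hφ x hx hm => by
    have h1 := hsup (fun y => -φ y) hφ.neg x hx.2 (by
      filter_upwards [hm] with y hy
      linarith)
    have h2 : μ * v x < μ * v q + 1 := hx.1
    have h3 : gradient (fun y => -φ y) x = -gradient φ x := by
      simp [gradient, fderiv_fun_neg]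
    rw [lapl_neg, h3, norm_neg] at h1
    linarith
  have hHc : Continuous fun a : Euc N => ‖a‖ ^ m :=
    continuous_norm.rpow_const fun _ => Or.inr hm
  have key := doubling_radial hN hv hv.neg hU hV hHc hHc.fun_neg hvU hvV hne hk hk' hk'' hmax
  have := mul_le_mul_of_nonneg_left hle hμ
  linarith

theorem norm_rpow_sub_norm_rpow_le {E : Type*} [NormedAddCommGroup E] [NormedSpace ℝ E]
    {m c L A δ : ℝ} (hm : 1 < m) (hA : 0 ≤ A) {z p q : E} (hz : z ≠ 0) (hc : |c| ≤ L)
    (hq : 2 * A * ‖q‖ ≤ L) (hpq : ‖p‖ + ‖q‖ ≤ δ) :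
    ‖-((c / ‖z‖) • z) + (2 * A) • q‖ ^ m - ‖(c / ‖z‖) • z + (2 * A) • p‖ ^ m
      ≤ m * (2 * L) ^ (m - 1) * (2 * A * δ) := by
  have hz' : 0 < ‖z‖ := norm_pos_iff.2 hz
  set a := (c / ‖z‖) • z with ha
  have han : ‖a‖ = |c| := by
    rw [ha, norm_smul, norm_div, norm_norm, Real.norm_eq_abs, div_mul_cancel₀ _ hz'.ne']
  have hsm (r : E) : ‖(2 * A) • r‖ = 2 * A * ‖r‖ := by
    rw [norm_smul, Real.norm_of_nonneg (by positivity)]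
  have hb : ‖-a + (2 * A) • q‖ ≤ 2 * L := by
    have := norm_add_le (-a) ((2 * A) • q)
    rw [norm_neg, han, hsm] at this
    linarith
  have hL : 0 ≤ L := (abs_nonneg c).trans hc
  have hδ : 0 ≤ δ := le_trans (by positivity) hpq
  have hd : ‖-a + (2 * A) • q‖ - ‖a + (2 * A) • p‖ ≤ 2 * A * δ := by
    have h1 := norm_sub_norm_le (-a + (2 * A) • q) (-(a + (2 * A) • p))
    rw [norm_neg, show -a + (2 * A) • q - -(a + (2 * A) • p) = (2 * A) • (p + q) by
      rw [smul_add]; abel, hsm] at h1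
    have h2 := mul_le_mul_of_nonneg_left ((norm_add_le p q).trans hpq)
      (show 0 ≤ 2 * A by positivity)
    linarith
  refine (rpow_sub_rpow_le (norm_nonneg _) (norm_nonneg _) hm).trans ?_
  have h0 : 0 ≤ m * ‖-a + (2 * A) • q‖ ^ (m - 1) := by positivity
  refine (mul_le_mul_of_nonneg_left hd h0).trans ?_
  gcongr

set_option maxHeartbeats 800000 in
/-- Interior Lipschitz bound for viscosity solutions of `-Δv + |Dv|^m + μ v = g`, where
`|g| ≤ K` and `μ v ≥ -K`. -/
theorem exists_lipschitz_bound {N : ℕ} (hN : 1 ≤ N) {m : ℝ} (hm : 2 < m) {K : ℝ} (hK : 0 ≤ K) :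
    ∃ Λ : ℝ, 0 < Λ ∧ ∀ (v : Euc N → ℝ) (μ : ℝ), Continuous v → 0 ≤ μ →
      (∀ x ∈ ball (0 : Euc N) 2, -K ≤ μ * v x) →
      (∀ φ : Euc N → ℝ, ContDiff ℝ 2 φ → ∀ x ∈ ball (0 : Euc N) 2,
        IsLocalMax (fun y => v y - φ y) x → -lapl φ x + ‖gradient φ x‖ ^ m + μ * v x ≤ K) →
      (∀ φ : Euc N → ℝ, ContDiff ℝ 2 φ → ∀ x ∈ ball (0 : Euc N) 2,
        IsLocalMin (fun y => v y - φ y) x → -K ≤ -lapl φ x + ‖gradient φ x‖ ^ m + μ * v x) →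
      ∀ y, ‖y‖ ≤ 1 / 4 → |v y - v 0| ≤ Λ * ‖y‖ := by
  obtain ⟨C₀, hC₀, hhol⟩ := exists_holder_bound N hm (C := 2 * K) (by positivity)
  set α := (m - 2) / (m - 1) with hα
  have hm1 : 0 < m - 1 := by linarith
  have hα0 : 0 < α := div_pos (by linarith) hm1
  have hα1 : α < 1 := by rw [hα, div_lt_one hm1]; linarith
  have hαm : (α - 1) * (m - 1) = -1 := by rw [hα]; field_simp; ring
  obtain ⟨A, hA⟩ : ∃ A, A = 16 * C₀ + 16 := ⟨_, rfl⟩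
  obtain ⟨θ, hθ⟩ : ∃ θ, θ = α / 2 := ⟨_, rfl⟩
  have hθ0 : 0 < θ := by linarith
  obtain ⟨Q, hQ⟩ : ∃ Q, Q = 4 * N * A + (2 * K + 2) +
      m * (2 ^ (m - 1) * (2 * C₀) ^ (m - 1)) * (2 * A) := ⟨_, rfl⟩
  have hA0 : 0 < A := by linarith
  have hQ0 : 0 < Q := by rw [hQ]; positivity
  obtain ⟨L, hL⟩ : ∃ L, L = A + Q / (2 * (θ * (1 + θ))) := ⟨_, rfl⟩
  have hLQ : Q < 2 * L * (θ * (1 + θ)) := by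
    have : 2 * L * (θ * (1 + θ)) = 2 * A * (θ * (1 + θ)) + Q := by rw [hL]; field_simp
    rw [this]
    have : 0 < 2 * A * (θ * (1 + θ)) := by positivity
    linarith
  have hLA : A ≤ L := by rw [hL]; linarith [show 0 ≤ Q / (2 * (θ * (1 + θ))) by positivity]
  have hL0 : 0 < L := by linarith
  refine ⟨L + A, by positivity, fun v μ hv hμ hlow hsub hsup => ?_⟩
  let k : ℝ → ℝ := fun t => L * (t - 1 / 2 * t ^ (1 + θ))
  have hkc : Continuous k := by
    have : Continuous fun t : ℝ => t ^ (1 + θ) := Real.continuous_rpow_const (by linarith)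
    fun_prop
  have hpen : ∀ x ∈ closedBall (0 : Euc N) (1 / 4), ∀ y ∈ closedBall (0 : Euc N) (1 / 4),
      v x - v y ≤ k ‖x - y‖ + (A * ‖x‖ ^ 2 + A * ‖y‖ ^ 2) := by
    have hne : (closedBall (0 : Euc N) (1 / 4)).Nonempty := ⟨0, by simp⟩
    have hcont : Continuous fun z : Euc N × Euc N =>
        v z.1 + -v z.2 - (k ‖z.1 - z.2‖ + (A * ‖z.1‖ ^ 2 + A * ‖z.2‖ ^ 2)) := by fun_prop
    obtain ⟨⟨p, q⟩, hpq, hmax⟩ := ((isCompact_closedBall (0 : Euc N) (1 / 4)).prod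
      (isCompact_closedBall (0 : Euc N) (1 / 4))).exists_isMaxOn (hne.prod hne) hcont.continuousOn
    by_contra! hcon
    obtain ⟨x, hx, y, hy, hxy⟩ := hcon
    have hpos : 0 < v p + -v q - (k ‖p - q‖ + (A * ‖p‖ ^ 2 + A * ‖q‖ ^ 2)) :=
      lt_of_lt_of_le (by dsimp only; linarith) (hmax (mk_mem_prod hx hy))
    have hp : ‖p‖ ≤ 1 / 4 := by simpa using hpq.1
    have hq : ‖q‖ ≤ 1 / 4 := by simpa using hpq.2
    have hk0 : k 0 = 0 := by simp [k, Real.zero_rpow (show 1 + θ ≠ 0 by positivity)]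
    have hne : p ≠ q := by
      rintro rfl
      rw [sub_self, norm_zero, hk0] at hpos
      have : 0 ≤ A * ‖p‖ ^ 2 := by positivity
      linarith
    have hs : 0 < ‖p - q‖ := norm_pos_iff.2 (sub_ne_zero.2 hne)
    have hs1 : ‖p - q‖ ≤ 1 / 2 := (norm_sub_le p q).trans (by linarith)
    have hball : ball q 1 ⊆ ball (0 : Euc N) 2 := fun z hz => by
      rw [mem_ball_iff_norm] at hz
      rw [mem_ball_zero_iff]
      linarith [norm_le_norm_add_norm_sub' z q]
    have hvs : v p - v q ≤ C₀ * ‖p - q‖ ^ α := by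
      refine hhol v hv q (fun φ hφ x hx hm => ?_) p hs1
      have := hsub φ hφ x (hball hx) hm
      have := hlow x (hball hx)
      linarith
    set s := ‖p - q‖ with hsdef
    have hsθ : s ^ θ ≤ 1 := Real.rpow_le_one hs.le (by linarith) hθ0.le
    have hsθ' : 0 < s ^ θ := by positivity
    have hs1θ : s ^ (1 + θ) = s * s ^ θ := by rw [Real.rpow_add hs, Real.rpow_one]
    have hks : L * s / 2 ≤ k s := by
      simp only [k, hs1θ]
      nlinarith [mul_le_mul_of_nonneg_left hsθ (mul_nonneg hL0.le hs.le)]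
    have hsα : s ^ α ≤ 1 := Real.rpow_le_one hs.le (by linarith) hα0.le
    have hks0 : 0 ≤ k s := le_trans (by positivity) hks
    have hp2 : 0 ≤ A * ‖p‖ ^ 2 := by positivity
    have hq2 : 0 ≤ A * ‖q‖ ^ 2 := by positivity
    have hLs : L < 2 * C₀ * s ^ (α - 1) := by
      rw [Real.rpow_sub_one hs.ne', mul_div_assoc', lt_div_iff₀ hs]
      linarith
    have hAs : A * (‖p‖ ^ 2 + ‖q‖ ^ 2) < C₀ * s ^ α := by linarith
    have hAs' : ‖p‖ ^ 2 + ‖q‖ ^ 2 < s ^ α / 16 := by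
      have h1 : 0 < s ^ α := by positivity
      have h2 : C₀ * s ^ α ≤ A * (s ^ α / 16) := by rw [hA]; nlinarith
      exact lt_of_mul_lt_mul_left (hAs.trans_le h2) hA0.le
    have hp' : ‖p‖ < 1 / 4 := by
      refine lt_of_pow_lt_pow_left₀ 2 (by norm_num) ?_
      linarith [sq_nonneg ‖q‖]
    have hq' : ‖q‖ < 1 / 4 := by
      refine lt_of_pow_lt_pow_left₀ 2 (by norm_num) ?_
      linarith [sq_nonneg ‖p‖]
    have hpqs : ‖p‖ + ‖q‖ ≤ s ^ θ := by
      refine le_of_sq_le_sq ?_ hsθ'.le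
      rw [← Real.rpow_natCast (s ^ θ), ← Real.rpow_mul hs.le,
        show θ * (2 : ℕ) = α by rw [hθ]; push_cast; ring]
      nlinarith [sq_nonneg (‖p‖ - ‖q‖), show 0 < s ^ α by positivity]
    have hloc : IsLocalMax (fun z : Euc N × Euc N =>
        v z.1 + -v z.2 - (k ‖z.1 - z.2‖ + (A * ‖z.1‖ ^ 2 + A * ‖z.2‖ ^ 2))) (p, q) := by
      filter_upwards [prod_mem_nhds (closedBall_mem_nhds_of_mem (mem_ball_zero_iff.2 hp'))
        (closedBall_mem_nhds_of_mem (mem_ball_zero_iff.2 hq'))] with z hz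
      exact hmax hz
    let k' : ℝ → ℝ := fun t => L * (1 - 1 / 2 * ((1 + θ) * t ^ θ))
    have hk' (t : ℝ) : HasDerivAt k (k' t) t := by
      have := ((hasDerivAt_id t).sub ((Real.hasDerivAt_rpow_const (x := t) (p := 1 + θ)
        (Or.inr (by linarith))).const_mul (1 / 2))).const_mul L
      simpa [k, k'] using this
    have hk'' : HasDerivAt k' (L * (0 - 1 / 2 * ((1 + θ) * (θ * s ^ (θ - 1))))) s :=
      ((hasDerivAt_const s (1 : ℝ)).sub (((Real.hasDerivAt_rpow_const (x := s) (p := θ)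
        (Or.inl hs.ne')).const_mul (1 + θ)).const_mul (1 / 2))).const_mul L
    have hkcd : ContDiffAt ℝ 2 k s :=
      contDiffAt_const.mul (contDiffAt_id.sub
        (contDiffAt_const.mul (contDiffAt_id.rpow_const_of_ne hs.ne')))
    have h2 : ball (0 : Euc N) (1 / 4) ⊆ ball 0 2 := ball_subset_ball (by norm_num)
    have key := doubling_solution hN (by linarith) hμ hv isOpen_ball hsub hsup
      (h2 (mem_ball_zero_iff.2 hp')) (h2 (mem_ball_zero_iff.2 hq')) hne (by linarith)
      (k := k) (k' := k') hkcd (.of_forall hk') hk'' hloc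
    have hk's : |k' s| ≤ L := by
      have h3 : 1 / 2 * ((1 + θ) * s ^ θ) ≤ 1 := by nlinarith
      have h4 : 0 ≤ 1 / 2 * ((1 + θ) * s ^ θ) := by positivity
      rw [abs_of_nonneg (mul_nonneg hL0.le (by linarith))]
      exact mul_le_of_le_one_right hL0.le (by linarith)
    have hgr := norm_rpow_sub_norm_rpow_le (m := m) (by linarith) hA0.le (sub_ne_zero.2 hne) hk's
      (show 2 * A * ‖q‖ ≤ L by nlinarith) hpqs
    have hLm : (2 * L) ^ (m - 1) ≤ 2 ^ (m - 1) * (2 * C₀) ^ (m - 1) * s⁻¹ := by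
      rw [Real.mul_rpow zero_le_two hL0.le, mul_assoc]
      refine mul_le_mul_of_nonneg_left ?_ (by positivity)
      have h3 := Real.rpow_le_rpow hL0.le hLs.le hm1.le
      rwa [Real.mul_rpow (by positivity) (by positivity), ← Real.rpow_mul hs.le, hαm,
        Real.rpow_neg_one] at h3
    have hsθ1 : s ^ (θ - 1) = s⁻¹ * s ^ θ := by
      rw [Real.rpow_sub_one hs.ne', div_eq_inv_mul]
    have hsθ2 : 1 ≤ s⁻¹ * s ^ θ := by
      rw [← hsθ1]
      exact Real.one_le_rpow_of_pos_of_le_one_of_nonpos hs (by linarith) (by linarith)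
    have h5 : m * (2 * L) ^ (m - 1) * (2 * A * s ^ θ) ≤
        m * (2 ^ (m - 1) * (2 * C₀) ^ (m - 1)) * (2 * A) * (s⁻¹ * s ^ θ) := by
      calc _ ≤ m * (2 ^ (m - 1) * (2 * C₀) ^ (m - 1) * s⁻¹) * (2 * A * s ^ θ) := by gcongr
        _ = _ := by ring
    have h6 : 4 * N * A + (2 * K + 2) ≤ (4 * N * A + (2 * K + 2)) * (s⁻¹ * s ^ θ) :=
      le_mul_of_one_le_right (by positivity) hsθ2
    have h7 : 2 * L * (θ * (1 + θ)) * (s⁻¹ * s ^ θ) ≤ Q * (s⁻¹ * s ^ θ) := by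
      rw [hQ, add_mul]
      rw [hsθ1] at key
      linarith
    exact absurd (le_of_mul_le_mul_right h7 (by linarith)) (not_le.2 hLQ)
  intro y hy
  have hk (t : ℝ) (ht : 0 ≤ t) : k t ≤ L * t := by
    have : 0 ≤ t ^ (1 + θ) := by positivity
    simp only [k]
    nlinarith
  have h0 : (0 : Euc N) ∈ closedBall (0 : Euc N) (1 / 4) := by simp
  have hy' : y ∈ closedBall (0 : Euc N) (1 / 4) := by simpa using hy
  have h1 := hpen y hy' 0 h0
  have h2 := hpen 0 h0 y hy'
  have h3 := hk ‖y‖ (norm_nonneg y)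
  simp only [sub_zero, zero_sub, norm_neg, norm_zero] at h1 h2
  have h4 : A * ‖y‖ ^ 2 ≤ A * ‖y‖ :=
    mul_le_mul_of_nonneg_left (by nlinarith [norm_nonneg y]) hA0.le
  rw [abs_le]
  constructor <;> linarith

/-- The stationary operator on the test function rescaled by `x ↦ (x - c) / r`. -/
theorem statOp_rescale {N : ℕ} {m : ℝ} (hm : 1 < m) (h : Euc N → ℝ) (lam : ℝ) {φ : Euc N → ℝ}
    (hφ : ContDiff ℝ 2 φ) {r : ℝ} (hr : 0 < r) (c y : Euc N) (t : ℝ) :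
    statOp h lam m (fun x => r ^ ((m - 2) / (m - 1)) * φ (r⁻¹ • (x - c))) t (c + r • y)
      = r ^ (-(m / (m - 1))) * (-lapl φ y + ‖gradient φ y‖ ^ m) + lam * t - h (c + r • y) := by
  have hm1 : m - 1 ≠ 0 := by linarith
  set a := r ^ ((m - 2) / (m - 1)) with ha
  have ha0 : 0 < a := by positivity
  have hψ : ContDiff ℝ 2 fun x => a * φ x := contDiff_const.mul hφ
  have hc : -(r⁻¹ • c) + r⁻¹ • (c + r • y) = y := by
    rw [smul_add, smul_smul, inv_mul_cancel₀ hr.ne', one_smul]; abel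
  have heq : (fun x => a * φ (r⁻¹ • (x - c))) = fun x => a * φ (-(r⁻¹ • c) + r⁻¹ • x) := by
    ext x
    rw [smul_sub, neg_add_eq_sub]
  have hl : lapl (fun x => a * φ (-(r⁻¹ • c) + r⁻¹ • x)) (c + r • y)
      = r⁻¹ ^ 2 * (a * lapl φ y) := by
    have := lapl_comp_similarity hψ (-(r⁻¹ • c)) r⁻¹ (LinearIsometryEquiv.refl ℝ _) (c + r • y)
    simp only [LinearIsometryEquiv.coe_refl, id_eq] at this
    rw [this, hc, lapl_const_mul a hφ.contDiffAt]
  have hg : gradient (fun x => a * φ (-(r⁻¹ • c) + r⁻¹ • x)) (c + r • y)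
      = (r⁻¹ * a) • gradient φ y := by
    have := gradient_comp_smul (hψ.differentiable two_ne_zero) (-(r⁻¹ • c)) r⁻¹ (c + r • y)
    rw [this, hc, mul_smul]
    congr 1
    simp [gradient, fderiv_const_mul (hφ.differentiable two_ne_zero y)]
  have e₁ : r⁻¹ ^ 2 * a = r ^ (-(m / (m - 1))) := by
    rw [ha, ← Real.rpow_neg_one, ← Real.rpow_natCast, ← Real.rpow_mul hr.le, ← Real.rpow_add hr]
    congr 1
    push_cast
    field_simp
    ring
  have e₂ : (r⁻¹ * a) ^ m = r ^ (-(m / (m - 1))) := by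
    rw [ha, ← Real.rpow_neg_one, ← Real.rpow_add hr, ← Real.rpow_mul hr.le]
    congr 1
    field_simp
    ring
  rw [statOp, heq, hl, hg, norm_smul, Real.norm_of_nonneg (by positivity),
    Real.mul_rpow (by positivity) (norm_nonneg _), e₂, ← mul_assoc, e₁]
  ring

theorem ball_infDist_frontier_subset {E : Type*} [NormedAddCommGroup E] [NormedSpace ℝ E]
    {s : Set E} {x : E} (hx : x ∈ s) : ball x (infDist x (frontier s)) ⊆ s := by
  rcases (infDist_nonneg (x := x) (s := frontier s)).eq_or_lt' with hd | hd
  · simp [hd]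
  have hdisj (y : E) (hy : y ∈ ball x (infDist x (frontier s))) : y ∉ frontier s := fun hyf => by
    rw [mem_ball, dist_comm] at hy
    linarith [infDist_le_dist_of_mem (x := x) hyf]
  refine (IsPreconnected.subset_left_of_subset_union isOpen_interior isClosed_closure.isOpen_compl
    (disjoint_compl_right_iff_subset.2 interior_subset_closure) (fun y hy => ?_)
    ⟨x, mem_ball_self hd, ?_⟩ (convex_ball x _).isPreconnected).trans interior_subset
  · by_contra h
    rw [mem_union, not_or, mem_compl_iff, not_not] at h
    exact hdisj y hy ⟨h.2, h.1⟩
  · by_contra h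
    exact hdisj x (mem_ball_self hd) ⟨subset_closure hx, h⟩

theorem IsSCSolution.neg_le {N : ℕ} {Ω : Set (Euc N)} {f u : Euc N → ℝ} {lam m M : ℝ}
    (hΩ : Bornology.IsBounded Ω) (hne : Ω.Nonempty) (hlam : 0 ≤ lam) (hm : 0 < m)
    (hM : ∀ x ∈ closure Ω, |f x| ≤ M) (hu : IsSCSolution Ω f lam m u) :
    ∀ x ∈ closure Ω, -M ≤ lam * u x := by
  obtain ⟨z, hz, hmin⟩ := hΩ.isCompact_closure.exists_isMinOn hne.closure hu.1
  intro x hx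
  have h1 := hu.2.2 (fun _ => 0) contDiff_const z hz (IsMinOn.localize (by
    intro y hy
    simpa using hmin hy))
  have h2 : gradient (fun _ : Euc N => (0 : ℝ)) z = 0 := by simp [gradient]
  rw [statOp, lapl_const, h2, norm_zero, Real.zero_rpow hm.ne'] at h1
  have h3 := neg_le_of_abs_le (hM z hz)
  have h4 := mul_le_mul_of_nonneg_left (isMinOn_iff.1 hmin x hx) hlam
  linarith

/-- Quantitative interior Lipschitz estimate for state-constraint solutions. -/
theorem exists_interior_lipschitz_bound {N : ℕ} (hN : 1 ≤ N) {Ω : Set (Euc N)}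
    (hΩb : Bornology.IsBounded Ω) (hΩo : IsOpen Ω) (hne : (frontier Ω).Nonempty)
    {m : ℝ} (hm : 2 < m) {f : Euc N → ℝ} (hf : ContinuousOn f (closure Ω)) :
    ∃ Λ > (0 : ℝ), ∀ lam : ℝ, 0 < lam → ∀ u : Euc N → ℝ, IsSCSolution Ω f lam m u →
      ∀ c ∈ Ω, ∀ x, ‖x - c‖ ≤ infDist c (frontier Ω) / 8 →
        |u x - u c| ≤ Λ * infDist c (frontier Ω) ^ (-(1 / (m - 1))) * ‖x - c‖ := by
  have hm1 : 0 < m - 1 := by linarith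
  have hcpt := hΩb.isCompact_closure
  obtain ⟨M, hM⟩ := hcpt.exists_bound_of_continuousOn hf
  simp only [Real.norm_eq_abs] at hM
  obtain ⟨z, hz⟩ := hne
  have hM0 : 0 ≤ M := (abs_nonneg _).trans (hM z (frontier_subset_closure hz))
  obtain ⟨D, hD⟩ := hΩb.subset_closedBall z
  set β := m / (m - 1) with hβ
  obtain ⟨Λ, hΛ, hlip⟩ := exists_lipschitz_bound hN hm (K := M * |D| ^ β) (by positivity)
  refine ⟨Λ * 2 ^ (1 / (m - 1)), by positivity, fun lam hlam u hu c hc x hx => ?_⟩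
  set d := infDist c (frontier Ω) with hd
  have hd0 : 0 < d := by
    refine (isClosed_frontier.notMem_iff_infDist_pos ⟨z, hz⟩).1 fun h => ?_
    exact (hΩo.frontier_eq ▸ h).2 hc
  have hball := ball_infDist_frontier_subset hc
  obtain ⟨r, hr⟩ : ∃ r, r = d / 2 := ⟨_, rfl⟩
  have hr0 : 0 < r := by linarith
  have hrD : r ≤ |D| := by
    have h1 := infDist_le_dist_of_mem (x := c) hz
    have h2 := mem_closedBall.1 (hD hc)
    linarith [le_abs_self D]
  have hKr : M * r ^ β ≤ M * |D| ^ β := by gcongr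
  obtain ⟨g, hg⟩ := ContinuousMap.exists_restrict_eq isClosed_closure
    ⟨(closure Ω).domRestrict u, hu.1.domRestrict⟩
  have hgu (y : Euc N) (hy : y ∈ closure Ω) : g y = u y := DFunLike.congr_fun hg ⟨y, hy⟩
  set α := (m - 2) / (m - 1) with hα
  have hmem (y : Euc N) (hy : y ∈ ball (0 : Euc N) 2) : c + r • y ∈ Ω := by
    refine hball ?_
    rw [mem_ball_zero_iff] at hy
    rw [mem_ball_iff_norm, add_sub_cancel_left, norm_smul, Real.norm_of_nonneg hr0.le]
    have := mul_lt_mul_of_pos_left hy hr0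
    linarith
  have e₁ : lam * r ^ 2 * r ^ (-α) = lam * r ^ β := by
    rw [mul_assoc, ← Real.rpow_natCast, ← Real.rpow_add hr0]
    congr 2
    rw [hα, hβ]
    push_cast
    field_simp
    ring
  have hval (y : Euc N) (hy : y ∈ ball (0 : Euc N) 2) :
      lam * r ^ 2 * (r ^ (-α) * g (c + r • y)) = r ^ β * (lam * u (c + r • y)) := by
    rw [← mul_assoc, e₁, hgu _ (subset_closure (hmem y hy))]
    ring
  have hinv (y : Euc N) : c + r • r⁻¹ • (y - c) = y := by
    rw [smul_smul, mul_inv_cancel₀ hr0.ne', one_smul, add_sub_cancel]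
  have hinv' (y : Euc N) : r⁻¹ • (c + r • y - c) = y := by
    rw [add_sub_cancel_left, smul_smul, inv_mul_cancel₀ hr0.ne', one_smul]
  have htend (y : Euc N) : Tendsto (fun z : Euc N => r⁻¹ • (z - c)) (𝓝 (c + r • y)) (𝓝 y) := by
    have : ContinuousAt (fun z : Euc N => r⁻¹ • (z - c)) (c + r • y) := by fun_prop
    simpa only [ContinuousAt, hinv'] using this
  have hrα : r ^ α * r ^ (-α) = 1 := by rw [← Real.rpow_add hr0, add_neg_cancel, Real.rpow_zero]
  have hrβ : r ^ β * r ^ (-β) = 1 := by rw [← Real.rpow_add hr0, add_neg_cancel, Real.rpow_zero]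
  have hrβ0 : 0 < r ^ β := by positivity
  have hsm (φ : Euc N → ℝ) (hφ : ContDiff ℝ 2 φ) :
      ContDiff ℝ 2 fun x => r ^ α * φ (r⁻¹ • (x - c)) :=
    contDiff_const.mul (hφ.comp ((contDiff_id.sub contDiff_const).const_smul r⁻¹))
  have main := hlip (fun y => r ^ (-α) * g (c + r • y)) (lam * r ^ 2) (by fun_prop) (by positivity)
    (fun y hy => by
      rw [hval y hy]
      have := mul_le_mul_of_nonneg_left (hu.neg_le hΩb ⟨c, hc⟩ hlam.le (by linarith) hM _
        (subset_closure (hmem y hy))) hrβ0.le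
      linarith)
    (fun φ hφ y hy hmax => by
      have h1 := hu.2.1 _ (hsm φ hφ) (c + r • y) (hmem y hy) (by
        filter_upwards [nhdsWithin_le_nhds ((htend y).eventually hmax), self_mem_nhdsWithin]
          with z hz hzΩ
        simp only [hinv, Pi.sub_apply, hinv'] at hz ⊢
        rw [hgu _ (subset_closure hzΩ), hgu _ (subset_closure (hmem y hy))] at hz
        have := mul_le_mul_of_nonneg_left hz (show 0 ≤ r ^ α by positivity)
        rw [mul_sub, mul_sub, ← mul_assoc, ← mul_assoc, hrα, one_mul, one_mul] at this
        exact this)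
      rw [statOp_rescale (by linarith) _ _ hφ hr0] at h1
      rw [hval y hy]
      have h2 := mul_le_mul_of_nonneg_left h1 hrβ0.le
      have h3 := mul_le_mul_of_nonneg_left (le_of_abs_le (hM _ (subset_closure (hmem y hy))))
        hrβ0.le
      rw [mul_sub, mul_add, ← mul_assoc, hrβ] at h2
      linarith)
    (fun φ hφ y hy hmin => by
      have h1 := hu.2.2 _ (hsm φ hφ) (c + r • y) (subset_closure (hmem y hy)) (by
        filter_upwards [nhdsWithin_le_nhds ((htend y).eventually hmin), self_mem_nhdsWithin]
          with z hz hzΩ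
        simp only [hinv, Pi.sub_apply, hinv'] at hz ⊢
        rw [hgu _ hzΩ, hgu _ (subset_closure (hmem y hy))] at hz
        have := mul_le_mul_of_nonneg_left hz (show 0 ≤ r ^ α by positivity)
        rw [mul_sub, mul_sub, ← mul_assoc, ← mul_assoc, hrα, one_mul, one_mul] at this
        exact this)
      rw [statOp_rescale (by linarith) _ _ hφ hr0] at h1
      rw [hval y hy]
      have h2 := mul_le_mul_of_nonneg_left h1 hrβ0.le
      have h3 := mul_le_mul_of_nonneg_left (neg_le_of_abs_le (hM _ (subset_closure (hmem y hy))))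
        hrβ0.le
      rw [mul_sub, mul_add, ← mul_assoc, hrβ] at h2
      linarith)
    (r⁻¹ • (x - c)) (by
      rw [norm_smul, norm_inv, Real.norm_of_nonneg hr0.le, inv_mul_le_iff₀ hr0]
      linarith)
  have hxΩ : x ∈ Ω := hball (mem_ball_iff_norm.2 (by linarith))
  simp only [hinv, smul_zero, add_zero] at main
  rw [hgu _ (subset_closure hxΩ), hgu _ (subset_closure hc), ← mul_sub, abs_mul,
    abs_of_pos (by positivity), norm_smul, norm_inv, Real.norm_of_nonneg hr0.le] at main
  have h1 := mul_le_mul_of_nonneg_left main (show 0 ≤ r ^ α by positivity)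
  rw [← mul_assoc, hrα, one_mul] at h1
  refine h1.trans_eq ?_
  have e₂ : r ^ α * r⁻¹ = 2 ^ (1 / (m - 1)) * d ^ (-(1 / (m - 1))) := by
    rw [← Real.rpow_neg_one r, ← Real.rpow_add hr0,
      show α + -1 = -(1 / (m - 1)) by rw [hα]; field_simp; ring, hr,
      Real.div_rpow hd0.le zero_le_two,
      Real.rpow_neg zero_le_two, div_inv_eq_mul, mul_comm]
  linear_combination (Λ * ‖x - c‖) * e₂

/-- Local interior gradient bound for the discounted
state-constraint solutions, Proposition 3.6 of the paper. -/
theorem stmt11 {N : ℕ} (hN : 1 ≤ N) (Ω : Set (Euc N))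
    (hΩo : IsOpen Ω) (hΩb : Bornology.IsBounded Ω) (hΩc : IsConnected Ω)
    (hΩ2 : HasC2Boundary Ω)
    (m : ℝ) (hm : 2 < m) (f : Euc N → ℝ) (hf : ContinuousOn f (closure Ω)) :
    ∃ Λ > (0 : ℝ), ∀ lam : ℝ, 0 < lam → lam < 1 →
      ∀ u : Euc N → ℝ, IsSCSolution Ω f lam m u →
        LocLipIn Ω u ∧
        ∀ x ∈ Ω, DifferentiableAt ℝ u x →
          ‖gradient u x‖ ≤ Λ * infDist x (frontier Ω) ^ (-(1 / (m - 1))) := by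
  have hm1 : 0 < m - 1 := by linarith
  have : Nonempty (Fin N) := ⟨⟨0, hN⟩⟩
  have hfr : (frontier Ω).Nonempty := nonempty_frontier_iff.2 ⟨hΩc.nonempty, fun h =>
    NormedSpace.unbounded_univ ℝ (Euc N) (h ▸ hΩb)⟩
  obtain ⟨Λ, hΛ, hlip⟩ := exists_interior_lipschitz_bound hN hΩb hΩo hfr hm hf
  have hpos (x : Euc N) (hx : x ∈ Ω) : 0 < infDist x (frontier Ω) :=
    (isClosed_frontier.notMem_iff_infDist_pos hfr).1 fun h => (hΩo.frontier_eq ▸ h).2 hx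
  refine ⟨Λ, hΛ, fun lam hlam _ u hu => ⟨fun x hx => ?_, fun x hx _ => ?_⟩⟩
  · have hd := hpos x hx
    set d := infDist x (frontier Ω) with hd_def
    refine ⟨d / 32, by positivity, Λ * (d / 2) ^ (-(1 / (m - 1))), by positivity,
      fun y hy z hz => ?_⟩
    have hyx := mem_ball.1 hy.1
    have hzx := mem_ball.1 hz.1
    have hdz : d / 2 ≤ infDist z (frontier Ω) := by
      have := infDist_le_infDist_add_dist (s := frontier Ω) (x := x) (y := z)
      rw [dist_comm] at this
      linarith
    have hyz : ‖y - z‖ ≤ infDist z (frontier Ω) / 8 := by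
      rw [← dist_eq_norm]
      linarith [dist_triangle_right y z x]
    refine (hlip lam hlam u hu z hz.2 y hyz).trans ?_
    gcongr Λ * ?_ * _
    exact Real.rpow_le_rpow_of_nonpos (by positivity) hdz (neg_nonpos.2 (by positivity))
  · have hd := hpos x hx
    rw [gradient, LinearIsometryEquiv.norm_map]
    refine norm_fderiv_le_of_lip' ℝ (by positivity) ?_
    filter_upwards [ball_mem_nhds x (show 0 < infDist x (frontier Ω) / 8 by positivity)] with y hy
    exact hlip lam hlam u hu x hx y (mem_ball_iff_norm.1 hy).le
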